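/- arXiv:2101.00247 — 3 statements merged into one kernel-verified Lean document; each statement's English description precedes it below -/
import Mathlib

section
/- A finite group G is a soluble PST-group if and only if for every prime p dividing |G|, every Sylow p-subgroup P of G, and every maximal subgroup V of P, there exists a subgroup T of G with VT = G such that T is a soluble PST-group. -/
open scoped Pointwise

/-- A subgroup `A` of `G` is S-permutable if it permutes with every Sylow subgroup
of `G`: `AQ = QA` for every Sylow `q`-subgroup `Q` and every prime `q`. -/
def SPermutable {G : Type*} [Group G] (A : Subgroup G) : Prop :=
  ∀ q : ℕ, q.Prime → ∀ Q : Sylow q G,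
    (A : Set G) * ((Q : Subgroup G) : Set G) = ((Q : Subgroup G) : Set G) * (A : Set G)

/-- `G` is a `PST`-group: S-permutability is transitive, i.e. whenever `H` is
S-permutable in `G` and `K` is S-permutable in `H`, then `K` is S-permutable in `G`. -/
def IsPST (G : Type*) [Group G] : Prop :=
  ∀ H : Subgroup G, SPermutable H →
    ∀ K : Subgroup ↥H, SPermutable K → SPermutable (K.map H.subtype)

theorem le_of_prime_power {G : Type*} [Group G] [Finite G] (K H : Subgroup G)
    (h : ∀ r : ℕ, r.Prime → ∀ x ∈ K, (∃ n : ℕ, x ^ (r ^ n) = 1) → x ∈ H) : K ≤ H := by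
  by_contra hc
  have h1 : H.relIndex K ≠ 1 := fun e => hc (Subgroup.relIndex_eq_one.mp e)
  obtain ⟨r, hr, hd⟩ := Nat.exists_prime_and_dvd h1
  have : Fact r.Prime := ⟨hr⟩
  obtain ⟨R⟩ : Nonempty (Sylow r K) := inferInstance
  have hle : (R : Subgroup K) ≤ H.subgroupOf K := by
    intro x hx
    rw [Subgroup.mem_subgroupOf]
    refine h r hr x x.2 ?_
    obtain ⟨k, hk⟩ := R.isPGroup' ⟨x, hx⟩
    refine ⟨k, ?_⟩
    have := congrArg (fun y : R => ((y : K) : G)) hk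
    simpa using this
  exact R.not_dvd_index (hd.trans (Subgroup.index_dvd_of_le hle))

theorem one_of_coprime_pow {G : Type*} [Group G] {z : G} {m n : ℕ} (h : m.Coprime n)
    (hm : z ^ m = 1) (hn : z ^ n = 1) : z = 1 := by
  have := Nat.dvd_gcd (orderOf_dvd_of_pow_eq_one hm) (orderOf_dvd_of_pow_eq_one hn)
  rw [h] at this
  exact orderOf_eq_one_iff.mp (Nat.dvd_one.mp this)

theorem mem_of_coprime_pow {G : Type*} [Group G] {H : Subgroup G} {z : G} {m n : ℕ}
    (h : m.Coprime n) (hm : z ^ m ∈ H) (hn : z ^ n = 1) : z ∈ H := by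
  have h1 := Nat.gcd_eq_gcd_ab m n
  rw [h] at h1
  have : z = (z ^ m) ^ (m.gcdA n) * (z ^ n) ^ (m.gcdB n) := by
    rw [← zpow_natCast, ← zpow_natCast, ← zpow_mul, ← zpow_mul, ← zpow_add, ← h1]; simp
  rw [this, hn, one_zpow, mul_one]
  exact H.zpow_mem hm _

theorem cop_comm {G : Type*} [Group G] {x a z : G} {m n : ℕ} (hx : x ^ m = 1)
    (h1 : x * a * x⁻¹ = a * z) (h2 : x * z * x⁻¹ = z) (hz : z ^ n = 1) (hmn : m.Coprime n) :
    z = 1 := by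
  have key : ∀ j : ℕ, x ^ j * a * (x ^ j)⁻¹ = a * z ^ j := by
    intro j
    induction j with
    | zero => simp
    | succ j ih =>
      have e : x ^ (j+1) * a * (x ^ (j+1))⁻¹ = x * (x ^ j * a * (x ^ j)⁻¹) * x⁻¹ := by
        rw [pow_succ']; group
      have e2 : x * z ^ j * x⁻¹ = z ^ j := by rw [← conj_pow, h2]
      rw [e, ih]
      calc x * (a * z ^ j) * x⁻¹ = (x * a * x⁻¹) * (x * z ^ j * x⁻¹) := by group
        _ = a * z ^ (j+1) := by rw [h1, e2, pow_succ', mul_assoc]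
  have := key m
  rw [hx] at this
  have hzm : z ^ m = 1 := by simpa using this
  exact one_of_coprime_pow hmn hzm hz

/-- `x` normalizes every subgroup of `P` -/
def NormAll {G : Type*} [Group G] (x : G) (P : Subgroup G) : Prop :=
  ∀ A : Subgroup G, A ≤ P → ∀ a ∈ A, x * a * x⁻¹ ∈ A

theorem NormAll.pow {G : Type*} [Group G] [Finite G] {x : G} {P : Subgroup G} (h : NormAll x P)
    {a : G} (ha : a ∈ P) : ∃ n : ℕ, x * a * x⁻¹ = a ^ n := by
  classical
  have := h (Subgroup.zpowers a) (by simpa using ha) a (by simp)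
  rw [mem_zpowers_iff_mem_range_orderOf] at this
  simp only [Finset.mem_image, Finset.mem_range] at this
  obtain ⟨n, -, hn⟩ := this
  exact ⟨n, hn.symm⟩

theorem cop_fix {G : Type*} [Group G] [Finite G] {p : ℕ} (hp : p.Prime) {P : Subgroup G}
    (hP : IsPGroup p P) {x : G} {m : ℕ} (hx : x ^ m = 1) (hm : m.Coprime p) (hn : NormAll x P)
    (hf : ∀ a ∈ P, a ^ p = 1 → x * a * x⁻¹ = a) : ∀ a ∈ P, x * a * x⁻¹ = a := by
  have key : ∀ k : ℕ, ∀ a ∈ P, a ^ (p ^ k) = 1 → x * a * x⁻¹ = a := by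
    intro k
    induction k with
    | zero => intro a _ h; simp at h; simp [h]
    | succ k ih =>
      intro a ha hk
      have h1 : x * a ^ p * x⁻¹ = a ^ p := ih _ (P.pow_mem ha p) (by rw [← pow_mul, ← pow_succ']; exact hk)
      obtain ⟨n, hna⟩ := hn.pow ha
      set z := a⁻¹ * a ^ n with hz
      have hzP : z ∈ P := P.mul_mem (P.inv_mem ha) (P.pow_mem ha n)
      have hzp : z ^ p = 1 := by
        have hc : Commute a⁻¹ (a ^ n) := (Commute.refl a).inv_left.pow_right n
        rw [hz, hc.mul_pow, ← hna, conj_pow, h1]; simp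
      have := cop_comm (a := a) hx (by rw [hna, hz]; group) (hf z hzP hzp) hzp hm
      rw [hna]
      rw [hz] at this
      exact (inv_mul_eq_one.mp this).symm
  intro a ha
  obtain ⟨k, hk⟩ := hP ⟨a, ha⟩
  exact key k a ha (by simpa [Subtype.ext_iff] using hk)

theorem pow_eq_of_modEq {G : Type*} [Group G] {d : G} {p n m : ℕ} (hd : d ^ p = 1)
    (h : n ≡ m [MOD p]) : d ^ n = d ^ m := by
  rw [pow_eq_pow_iff_modEq]
  exact h.of_dvd (orderOf_dvd_of_pow_eq_one hd)

theorem modEq_of_pow_eq {G : Type*} [Group G] {d : G} {p n m : ℕ} (hp : p.Prime) (hd : d ^ p = 1)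
    (h1 : d ≠ 1) (h : d ^ n = d ^ m) : n ≡ m [MOD p] := by
  have : Fact p.Prime := ⟨hp⟩
  rw [pow_eq_pow_iff_modEq, orderOf_eq_prime hd h1] at h
  exact h

theorem exists_order_p {G : Type*} [Group G] {p : ℕ} {a : G} {k : ℕ} (hk : a ^ (p ^ k) = 1)
    (ha : a ≠ 1) : ∃ j : ℕ, (a ^ (p ^ j)) ^ p = 1 ∧ a ^ (p ^ j) ≠ 1 := by
  induction k with
  | zero => simp at hk; exact absurd hk ha
  | succ k ih =>
    by_cases h : a ^ (p ^ k) = 1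
    · exact ih h
    · exact ⟨k, by rw [← pow_mul, ← pow_succ]; exact hk, h⟩

theorem uni_scalar {G : Type*} [Group G] [Finite G] {p : ℕ} (hp : p.Prime) {P : Subgroup G}
    (hP : IsPGroup p P) {x : G} (hn : NormAll x P) :
    ∃ l : ℕ, ∀ d ∈ P, d ^ p = 1 → x * d * x⁻¹ = d ^ l := by
  have : Fact p.Prime := ⟨hp⟩
  by_cases hb : P = ⊥
  · subst hb
    refine ⟨1, fun d hd _ => ?_⟩
    rw [Subgroup.mem_bot] at hd; simp [hd]
  have : Nontrivial P := (Subgroup.nontrivial_iff_ne_bot P).mpr hb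
  have := hP.center_nontrivial
  obtain ⟨⟨c0, hc0⟩, hc1⟩ := exists_ne (1 : Subgroup.center P)
  have hc2 : (c0 : G) ≠ 1 := by
    intro h; apply hc1; ext; simpa using h
  obtain ⟨k, hk⟩ := hP c0
  obtain ⟨j, hj1, hj2⟩ := exists_order_p (a := (c0 : G)) (p := p) (k := k)
    (by simpa [Subtype.ext_iff] using hk) hc2
  set c : G := (c0 : G) ^ (p ^ j) with hc
  have hcP : c ∈ P := P.pow_mem c0.2 _
  have hcomm : ∀ d ∈ P, Commute c d := by
    intro d hd
    have := Subgroup.mem_center_iff.mp hc0 ⟨d, hd⟩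
    have h2 : d * (c0 : G) = c0 * d := by simpa [Subtype.ext_iff] using this
    have h3 : Commute (c0 : G) d := h2.symm
    exact h3.pow_left _
  obtain ⟨l, hl⟩ := hn.pow hcP
  refine ⟨l, fun d hd hdp => ?_⟩
  by_cases hdc : d ∈ Subgroup.zpowers c
  · obtain ⟨i, rfl⟩ := Subgroup.mem_zpowers_iff.mp hdc
    rw [← conj_zpow, hl, ← zpow_natCast, ← zpow_natCast, ← zpow_mul, ← zpow_mul, mul_comm]
  · obtain ⟨m, hm⟩ := hn.pow hd
    obtain ⟨v, hv⟩ := hn.pow (P.mul_mem hcP hd)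
    have e1 : c ^ l * d ^ m = c ^ v * d ^ v := by
      rw [← (hcomm d hd).mul_pow, ← hv, ← hl, ← hm]; group
    have e2 : d ^ ((m : ℤ) - v) = c ^ ((v : ℤ) - l) := by
      have h4 : d ^ m * (d ^ v)⁻¹ = (c ^ l)⁻¹ * c ^ v := by
        rw [mul_inv_eq_iff_eq_mul, mul_assoc, ← e1]; group
      have : (c ^ l)⁻¹ * c ^ v = c ^ v * (c ^ l)⁻¹ :=
        (((Commute.refl c).pow_left v).pow_right l).inv_right.symm.eq
      rw [zpow_sub, zpow_sub, zpow_natCast, zpow_natCast, zpow_natCast, zpow_natCast, h4, this]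
    have e3 : (p : ℤ) ∣ (m : ℤ) - v := by
      by_contra hnd
      apply hdc
      have hcop : IsCoprime ((m : ℤ) - v) (p : ℤ) := by
        rw [isCoprime_comm]
        exact (Nat.prime_iff_prime_int.mp hp).coprime_iff_not_dvd.mpr hnd
      obtain ⟨s, t, hst⟩ := hcop
      have : d = (d ^ ((m : ℤ) - v)) ^ s := by
        rw [← zpow_mul, mul_comm]
        have : s * ((m : ℤ) - v) = 1 - t * p := by linarith
        rw [this, zpow_sub, mul_comm t, zpow_mul, zpow_natCast, hdp]; simp
      rw [this, e2, ← zpow_mul]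
      exact Subgroup.zpow_mem_zpowers _ _
    have e4 : d ^ m = d ^ v := pow_eq_of_modEq hdp
      ((Int.natCast_modEq_iff.mp ((Int.modEq_iff_dvd.mpr e3).symm)))
    have e5 : c ^ l = c ^ v := by rw [e4] at e1; exact mul_right_cancel e1
    have := modEq_of_pow_eq hp hj1 hj2 e5
    rw [hm, e4]
    exact pow_eq_of_modEq hdp this.symm

theorem abelian_of_act {G : Type*} [Group G] [Finite G] {p : ℕ} (hp : p.Prime) {P : Subgroup G}
    (hP : IsPGroup p P) {x : G} {m : ℕ} (hx : x ^ m = 1) (hm : m.Coprime p) (hn : NormAll x P)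
    (hnf : ¬ ∀ a ∈ P, x * a * x⁻¹ = a) : ∀ a ∈ P, ∀ b ∈ P, a * b = b * a := by
  have : Fact p.Prime := ⟨hp⟩
  obtain ⟨l, hl⟩ := uni_scalar hp hP hn
  have hl1 : ¬ l ≡ 1 [MOD p] := by
    intro h
    apply hnf
    refine cop_fix hp hP hx hm hn fun a ha hap => ?_
    rw [hl a ha hap, pow_eq_of_modEq hap h, pow_one]
  have hmod : ∀ a ∈ P, a ≠ 1 → ∀ n : ℕ, x * a * x⁻¹ = a ^ n → n ≡ l [MOD p] := by
    intro a ha ha1 n hna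
    obtain ⟨k, hk⟩ := hP ⟨a, ha⟩
    obtain ⟨j, hj1, hj2⟩ := exists_order_p (a := a) (p := p) (k := k)
      (by simpa [Subtype.ext_iff] using hk) ha1
    have h1 := hl _ (P.pow_mem ha (p ^ j)) hj1
    rw [← conj_pow, hna, ← pow_mul, mul_comm, pow_mul] at h1
    exact modEq_of_pow_eq hp hj1 hj2 h1
  by_contra hcon
  have hne : Subgroup.center P ≠ ⊤ := by
    intro h
    apply hcon
    intro a ha b hb
    have : (⟨b, hb⟩ : P) ∈ Subgroup.center P := by rw [h]; trivial
    have := Subgroup.mem_center_iff.mp this ⟨a, ha⟩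
    simpa [Subtype.ext_iff] using this
  have : Nontrivial (P ⧸ Subgroup.center P) := by
    rw [QuotientGroup.nontrivial_iff]; exact hne
  have := (hP.to_quotient (Subgroup.center P)).center_nontrivial
  obtain ⟨⟨a', ha'⟩, ha1⟩ := exists_ne (1 : Subgroup.center (P ⧸ Subgroup.center P))
  obtain ⟨a, rfl⟩ := QuotientGroup.mk_surjective a'
  have hac : a ∉ Subgroup.center P := by
    intro h
    apply ha1
    ext
    simpa using h
  rw [Subgroup.mem_center_iff] at hac
  push Not at hac
  obtain ⟨b, hb⟩ := hac
  have hcz : a * b * a⁻¹ * b⁻¹ ∈ Subgroup.center P := by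
    have := Subgroup.mem_center_iff.mp ha' (b : P ⧸ Subgroup.center P)
    rw [← QuotientGroup.eq_one_iff]
    have h2 : ((a * b * a⁻¹ * b⁻¹ : P) : P ⧸ Subgroup.center P) = (a : P ⧸ Subgroup.center P) * b * (a : P ⧸ Subgroup.center P)⁻¹ * (b : P ⧸ Subgroup.center P)⁻¹ := rfl
    rw [h2, ← this]; group
  have hc1 : a * b * a⁻¹ * b⁻¹ ≠ 1 := by
    intro h; exact hb (by rw [mul_inv_eq_one, mul_inv_eq_iff_eq_mul] at h; exact h.symm)
  set c := a * b * a⁻¹ * b⁻¹ with hc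
  have hcc : ∀ g : P, Commute c g := fun g => (Subgroup.mem_center_iff.mp hcz g).symm
  have hab : a * b = c * (b * a) := by rw [hc]; group
  have hab1 : ∀ i : ℕ, a * b ^ i = c ^ i * (b ^ i * a) := by
    intro i
    induction i with
    | zero => simp
    | succ i ih =>
      calc a * b ^ (i+1) = (a * b ^ i) * b := by rw [pow_succ, mul_assoc]
        _ = c ^ i * (b ^ i * (a * b)) := by rw [ih]; simp only [mul_assoc]
        _ = c ^ i * (b ^ i * c * (b * a)) := by rw [hab]; simp only [mul_assoc]
        _ = c ^ i * (c * b ^ i * (b * a)) := by rw [(hcc (b ^ i)).eq]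
        _ = _ := by rw [pow_succ, pow_succ]; simp only [mul_assoc]
  have hab2 : ∀ i j : ℕ, a ^ j * b ^ i = c ^ (i * j) * (b ^ i * a ^ j) := by
    intro i j
    induction j with
    | zero => simp
    | succ j ih =>
      calc a ^ (j+1) * b ^ i = a ^ j * (a * b ^ i) := by rw [pow_succ, mul_assoc]
        _ = (a ^ j * c ^ i) * (b ^ i * a) := by rw [hab1]; simp only [mul_assoc]
        _ = c ^ i * (a ^ j * b ^ i) * a := by
          rw [((hcc (a ^ j)).pow_left i).symm.eq]; simp only [mul_assoc]
        _ = _ := by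
          rw [ih, mul_add, mul_one, add_comm, pow_add, pow_succ]; simp only [mul_assoc]
  obtain ⟨n, hna⟩ := hn.pow a.2
  obtain ⟨n', hnb⟩ := hn.pow b.2
  obtain ⟨n'', hnc⟩ := hn.pow c.2
  have ha1' : (a : G) ≠ 1 := by
    intro h; apply hb; have : a = 1 := by ext; simpa using h
    simp [this]
  have hb1' : (b : G) ≠ 1 := by
    intro h; apply hb; have : b = 1 := by ext; simpa using h
    simp [this]
  have hc1' : (c : G) ≠ 1 := by
    intro h; apply hc1; ext; simpa using h
  have m1 := hmod a a.2 ha1' n hna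
  have m2 := hmod b b.2 hb1' n' hnb
  have m3 := hmod c c.2 hc1' n'' hnc
  have eG : (a : G) ^ n * (b : G) ^ n' = (c : G) ^ (n' * n) * ((b : G) ^ n' * (a : G) ^ n) := by
    have := congrArg (fun y : P => (y : G)) (hab2 n' n)
    simpa using this
  have eG2 : (a : G) ^ n * (b : G) ^ n' = (c : G) ^ n'' * ((b : G) ^ n' * (a : G) ^ n) := by
    have := congrArg (fun y : P => x * (y : G) * x⁻¹) hab
    simp only [Subgroup.coe_mul] at this
    rw [← hna, ← hnb, ← hnc]
    calc _ = x * (↑a * ↑b) * x⁻¹ := by group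
      _ = _ := by rw [this]; group
  have hcpow : (c : G) ^ (n' * n) = (c : G) ^ n'' := mul_right_cancel (eG.symm.trans eG2)
  obtain ⟨k, hk⟩ := hP c
  obtain ⟨j, hj1, hj2⟩ := exists_order_p (a := (c : G)) (p := p) (k := k)
      (by simpa [Subtype.ext_iff] using hk) hc1'
  have hm4 : n' * n ≡ n'' [MOD p] := by
    refine modEq_of_pow_eq hp hj1 hj2 ?_
    rw [← pow_mul, mul_comm, pow_mul, hcpow, ← pow_mul, mul_comm, pow_mul]
  have hll : l * l ≡ l * 1 [MOD p] := by
    rw [mul_one]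
    exact ((m2.mul m1).symm.trans hm4).trans m3
  have hpl : ¬ p ∣ l := by
    intro hd
    have h1 := hl _ (P.pow_mem c.2 (p ^ j)) hj1
    rw [pow_eq_of_modEq (m := 0) hj1 ((Nat.modEq_zero_iff_dvd).mpr hd), pow_zero] at h1
    exact hj2 (by simpa using h1)
  exact hl1 (Nat.ModEq.cancel_left_of_coprime ((Nat.Prime.coprime_iff_not_dvd hp).mpr hpl) hll)

theorem sylow_map_normal {G : Type*} [Group G] [Finite G] {M : Subgroup G} (hM : M.Normal)
    (hn : Group.IsNilpotent M) {q : ℕ} [Fact q.Prime] (R : Sylow q M) :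
    ((R : Subgroup M).map M.subtype).Normal := by
  have h1 : (R : Subgroup M).Normal := inferInstance
  have h2 := R.characteristic_of_normal h1
  infer_instance

theorem pelt_mem_sylow {G : Type*} [Group G] [Finite G] {q : ℕ} [hq : Fact q.Prime] {x : G} {n : ℕ}
    (hx : x ^ (q ^ n) = 1) : ∃ R : Sylow q G, x ∈ (R : Subgroup G) := by
  have : IsPGroup q (Subgroup.zpowers x) := by
    obtain ⟨k, -, hk⟩ := (Nat.dvd_prime_pow hq.out).mp (orderOf_dvd_of_pow_eq_one hx)
    exact IsPGroup.of_card (n := k) (by rw [Nat.card_zpowers, hk])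
  obtain ⟨R, hR⟩ := this.exists_le_sylow
  exact ⟨R, hR (Subgroup.mem_zpowers x)⟩

theorem pgroup_elt {G : Type*} [Group G] {q : ℕ} {P : Subgroup G} (hP : IsPGroup q P) {x : G}
    (hx : x ∈ P) : ∃ n : ℕ, x ^ (q ^ n) = 1 := by
  obtain ⟨k, hk⟩ := hP ⟨x, hx⟩
  exact ⟨k, by simpa [Subtype.ext_iff] using hk⟩

/-- prime power elements of a normal subgroup of coprime index -/
theorem mem_of_pelt {G : Type*} [Group G] [Finite G] {q : ℕ} {M : Subgroup G} (hM : M.Normal)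
    (hi : M.index.Coprime q) {x : G} {n : ℕ} (hx : x ^ (q ^ n) = 1) : x ∈ M := by
  refine mem_of_coprime_pow (m := M.index) (n := q ^ n) (hi.pow_right n) ?_ hx
  exact M.pow_index_mem x

theorem centralizer_core {G : Type*} [Group G] [Finite G] [Group.IsSolvable G] {p : ℕ} (hp : p.Prime)
    (hO : ∀ N : Subgroup G, N.Normal → p.Coprime (Nat.card N) → N = ⊥) {F : Subgroup G}
    (hF : F.Normal) (hFm : ∀ M : Subgroup G, M.Normal → IsPGroup p M → M ≤ F) :
    Subgroup.centralizer (F : Set G) ≤ F := by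
  by_contra hcon
  have hCn : (Subgroup.centralizer (F : Set G)).Normal := inferInstance
  obtain ⟨M, hM⟩ := (Set.toFinite {M : Subgroup G | M.Normal ∧
    M ≤ Subgroup.centralizer (F : Set G) ∧ ¬ M ≤ F}).exists_minimal ⟨_, hCn, le_rfl, hcon⟩
  obtain ⟨⟨hMn, hMC, hMF⟩, hmin⟩ := hM
  have hMb : M ≠ ⊥ := by rintro rfl; exact hMF bot_le
  have hlt := Group.IsSolvable.commutator_lt_of_ne_bot hMb
  have hcF : ⁅M, M⁆ ≤ F := by
    by_contra h
    exact hlt.not_ge (hmin ⟨inferInstance, hlt.le.trans hMC, h⟩ hlt.le)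
  have hnil : Group.IsNilpotent M := by
    refine isNilpotent_of_ker_le_center (Abelianization.of (G := M)) ?_
    intro x hx
    have hx' : x ∈ commutator M := by
      rw [Abelianization.ker_of] at hx; exact hx
    have hxF : (x : G) ∈ F := by
      apply hcF
      rw [← Subgroup.map_subtype_commutator]
      exact ⟨x, hx', rfl⟩
    rw [Subgroup.mem_center_iff]
    intro g
    have := Subgroup.mem_centralizer_iff.mp (hMC g.2) x hxF
    ext
    exact this.symm
  apply hMF
  refine le_of_prime_power M F ?_
  rintro r hr x hxM ⟨n, hn⟩
  have : Fact r.Prime := ⟨hr⟩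
  obtain ⟨R, hR⟩ := pelt_mem_sylow (q := r) (x := (⟨x, hxM⟩ : M)) (n := n) (by ext; simpa using hn)
  have hRn := sylow_map_normal hMn hnil R
  have hxR : x ∈ (R : Subgroup M).map M.subtype := ⟨_, hR, rfl⟩
  have hRp : IsPGroup r ((R : Subgroup M).map M.subtype) := R.isPGroup'.map _
  by_cases hrp : r = p
  · subst hrp
    exact hFm _ hRn hRp hxR
  · have : Fact p.Prime := ⟨hp⟩
    obtain ⟨k, hk⟩ := IsPGroup.iff_card.mp hRp
    have hb := hO _ hRn (by rw [hk]; exact ((Nat.coprime_primes hp hr).mpr (Ne.symm hrp)).pow_right k)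
    rw [hb, Subgroup.mem_bot] at hxR
    rw [hxR]; exact F.one_mem

theorem exists_normal_pgroup (G : Type*) [Group G] [Finite G] [Group.IsSolvable G] [Nontrivial G] :
    ∃ r : ℕ, r.Prime ∧ ∃ R : Subgroup G, R.Normal ∧ R ≠ ⊥ ∧ IsPGroup r R := by
  by_contra hcon
  push Not at hcon
  have h0 := centralizer_core (G := G) (p := 2) Nat.prime_two (F := ⊥) ?_ inferInstance ?_
  · apply (bot_ne_top (α := Subgroup G))
    symm
    rw [eq_bot_iff]
    intro a _
    apply h0
    rw [Subgroup.mem_centralizer_iff]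
    intro h hh
    have : h = 1 := hh
    simp [this]
  · intro N hN hc
    by_contra hb
    obtain ⟨M, ⟨⟨hMn, hMN, hMb⟩, hmin⟩⟩ := (Set.toFinite {M : Subgroup G | M.Normal ∧ M ≤ N ∧ M ≠ ⊥}).exists_minimal ⟨N, hN, le_rfl, hb⟩
    have hlt := Group.IsSolvable.commutator_lt_of_ne_bot hMb
    have hcF : ⁅M, M⁆ = ⊥ := by
      by_contra h
      exact hlt.not_ge (hmin ⟨inferInstance, hlt.le.trans hMN, h⟩ hlt.le)
    have hnil : Group.IsNilpotent M := by
      refine isNilpotent_of_ker_le_center (Abelianization.of (G := M)) ?_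
      intro x hx
      have hx' : x ∈ commutator M := by
        rw [Abelianization.ker_of] at hx; exact hx
      have hxF : (x : G) ∈ (⊥ : Subgroup G) := by
        rw [← hcF, ← Subgroup.map_subtype_commutator]
        exact ⟨x, hx', rfl⟩
      have : x = 1 := by ext; exact hxF
      rw [this]; exact Subgroup.one_mem _
    have hc1 : Nat.card M ≠ 1 := fun h => hMb (Subgroup.card_eq_one.mp h)
    obtain ⟨r, hr, hrd⟩ := Nat.exists_prime_and_dvd hc1
    have : Fact r.Prime := ⟨hr⟩
    obtain ⟨R⟩ : Nonempty (Sylow r M) := inferInstance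
    refine hcon r hr _ (sylow_map_normal hMn hnil R) ?_ (R.isPGroup'.map _)
    intro h
    rw [Subgroup.map_eq_bot_iff_of_injective _ M.subtype_injective] at h
    exact R.ne_bot_of_dvd_card hrd h
  · intro M hM hp
    by_contra h
    exact hcon 2 Nat.prime_two M hM (fun e => h (by rw [e])) hp

def XP (p : ℕ) (G : Type*) [Group G] : Prop :=
  ∃ N M : Subgroup G, N.Normal ∧ N ≤ M ∧ p.Coprime (Nat.card N) ∧ (∀ x ∈ M, ∃ k : ℕ, x ^ (p ^ k) ∈ N) ∧
    (M = ⊤ ∨ (M.index.Coprime p ∧ ∀ A : Subgroup G, N ≤ A → A ≤ M → A.Normal))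

theorem XP.map {G G' : Type*} [Group G] [Finite G] [Group G'] {p : ℕ} (hp : p.Prime) {f : G →* G'}
    (hf : Function.Surjective f) (h : XP p G) : XP p G' := by
  obtain ⟨N, M, hN, hNM, hc, hk, hor⟩ := h
  refine ⟨N.map f, M.map f, hN.map f hf, Subgroup.map_mono hNM, ?_, ?_, ?_⟩
  · exact Nat.Coprime.coprime_dvd_right (N.card_map_dvd f) hc
  · rintro _ ⟨x, hx, rfl⟩
    obtain ⟨k, hk⟩ := hk x hx
    exact ⟨k, by rw [← map_pow]; exact Subgroup.mem_map_of_mem f hk⟩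
  · rcases hor with rfl | ⟨hi, hA⟩
    · left; exact Subgroup.map_top_of_surjective f hf
    · right
      refine ⟨Nat.Coprime.coprime_dvd_left (M.index_map_dvd hf) hi, ?_⟩
      intro A hNA hAM
      have h1 : N ≤ A.comap f ⊓ M := le_inf (Subgroup.map_le_iff_le_comap.mp hNA) hNM
      have h2 := (hA _ h1 inf_le_right).map f hf
      have h3 : (A.comap f ⊓ M).map f = A := by
        apply le_antisymm
        · exact (Subgroup.map_mono inf_le_left).trans (Subgroup.map_comap_le _ _)
        · intro a ha
          obtain ⟨m, hm, rfl⟩ := hAM ha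
          exact ⟨m, ⟨ha, hm⟩, rfl⟩
      rw [h3] at h2
      exact h2

theorem card_comap {G : Type*} [Group G] (N : Subgroup G) [N.Normal] (B : Subgroup (G ⧸ N)) :
    Nat.card (B.comap (QuotientGroup.mk' N)) = Nat.card N * Nat.card B := by
  have h1 : N ≤ B.comap (QuotientGroup.mk' N) := by
    intro x hx
    rw [Subgroup.mem_comap]
    have : QuotientGroup.mk' N x = 1 := by simpa using hx
    rw [this]; exact B.one_mem
  have h2 := Subgroup.relIndex_mul_relIndex ⊥ N (B.comap (QuotientGroup.mk' N)) bot_le h1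
  rw [Subgroup.relIndex_bot_left, Subgroup.relIndex_bot_left] at h2
  have h3 := Subgroup.relIndex_ker (K := B.comap (QuotientGroup.mk' N)) (QuotientGroup.mk' N)
  rw [QuotientGroup.ker_mk', Subgroup.map_comap_eq_self_of_surjective (QuotientGroup.mk'_surjective N)] at h3
  rw [← h2, h3]

theorem XP.lift {G : Type*} [Group G] [Finite G] {p : ℕ} (N : Subgroup G) [N.Normal]
    (hN : p.Coprime (Nat.card N)) (h : XP p (G ⧸ N)) : XP p G := by
  obtain ⟨N', M, hN', hNM, hc, hk, hor⟩ := h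
  have hs := QuotientGroup.mk'_surjective N
  refine ⟨N'.comap (QuotientGroup.mk' N), M.comap (QuotientGroup.mk' N), inferInstance, Subgroup.comap_mono hNM, ?_, ?_, ?_⟩
  · rw [card_comap]; exact Nat.Coprime.mul_right hN hc
  · intro x hx
    obtain ⟨k, hk⟩ := hk _ hx
    exact ⟨k, by rw [Subgroup.mem_comap, map_pow]; exact hk⟩
  · rcases hor with rfl | ⟨hi, hA⟩
    · left; simp
    · right
      refine ⟨by rw [Subgroup.index_comap_of_surjective _ hs]; exact hi, ?_⟩
      intro A h1 h2
      have hker : (QuotientGroup.mk' N).ker ≤ A := (MonoidHom.ker_le_comap _ _).trans h1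
      have h3 : (A.map (QuotientGroup.mk' N)).comap (QuotientGroup.mk' N) = A :=
        Subgroup.comap_map_eq_self hker
      have h4 : (A.map (QuotientGroup.mk' N)).Normal := hA _ (by
          intro x hx
          obtain ⟨y, rfl⟩ := hs x
          exact ⟨y, h1 hx, rfl⟩) (Subgroup.map_le_iff_le_comap.mpr h2)
      rw [← h3]
      exact h4.comap _

theorem exists_core (G : Type*) [Group G] [Finite G] (p : ℕ) : ∃ N : Subgroup G, ∃ _ : N.Normal,
    p.Coprime (Nat.card N) ∧ ∀ B : Subgroup (G ⧸ N), B.Normal → p.Coprime (Nat.card B) → B = ⊥ := by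
  obtain ⟨N, ⟨⟨hN, hc⟩, hmax⟩⟩ := (Set.toFinite {M : Subgroup G | M.Normal ∧ p.Coprime (Nat.card M)}).exists_maximal ⟨⊥, inferInstance, by simp⟩
  refine ⟨N, hN, hc, fun B hB hBc => ?_⟩
  have h1 : N ≤ B.comap (QuotientGroup.mk' N) := by
    have := MonoidHom.ker_le_comap (QuotientGroup.mk' N) B
    rwa [QuotientGroup.ker_mk'] at this
  have := hmax ⟨hB.comap _, by rw [card_comap]; exact Nat.Coprime.mul_right hc hBc⟩ h1
  rw [eq_bot_iff]
  intro x hx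
  obtain ⟨y, rfl⟩ := QuotientGroup.mk'_surjective N x
  have : y ∈ N := this hx
  simpa using this

theorem XP.of_pgroup {G : Type*} [Group G] [Finite G] {p : ℕ} (hp : p.Prime) (h : IsPGroup p G) :
    XP p G := by
  have : Fact p.Prime := ⟨hp⟩
  refine ⟨⊥, ⊤, inferInstance, bot_le, by simp, ?_, Or.inl rfl⟩
  intro x _
  obtain ⟨k, hk⟩ := h x
  exact ⟨k, by rw [hk]; exact Subgroup.one_mem _⟩

theorem eq_one_of_mem_coprime {G : Type*} [Group G] {N : Subgroup G} {p k : ℕ}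
    (hc : p.Coprime (Nat.card N)) {n : G} (hn : n ∈ N) (hp : n ^ (p ^ k) = 1) : n = 1 := by
  refine one_of_coprime_pow (hc.pow_left k) hp ?_
  have := pow_card_eq_one' (x := (⟨n, hn⟩ : N))
  exact congrArg Subtype.val this

theorem normal_of_XP2 {G : Type*} [Group G] [Finite G] {p : ℕ} {N M R : Subgroup G} (hN : N.Normal)
    (hc : p.Coprime (Nat.card N)) (hNM : N ≤ M)
    (hA : ∀ A : Subgroup G, N ≤ A → A ≤ M → A.Normal) (hR : R.Normal)
    (hRp : IsPGroup p R) (hRM : R ≤ M) {A : Subgroup G} (hAR : A ≤ R) : A.Normal := by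
  have h1 : (A ⊔ N).Normal := hA _ le_sup_right (sup_le (hAR.trans hRM) hNM)
  constructor
  intro a ha g
  have h2 := h1.conj_mem a (Subgroup.mem_sup_left ha) g
  obtain ⟨b, hb, n, hn, hbn⟩ := Subgroup.mem_sup_of_normal_right.mp h2
  have h3 : n ∈ R := by
    have : n = b⁻¹ * (g * a * g⁻¹) := by rw [← hbn]; group
    rw [this]
    exact R.mul_mem (R.inv_mem (hAR hb)) (hR.conj_mem a (hAR ha) g)
  obtain ⟨k, hk⟩ := pgroup_elt hRp h3
  have := eq_one_of_mem_coprime hc hn hk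
  rw [← hbn, this, mul_one]; exact hb

theorem comm_of_disjoint {G : Type*} [Group G] {N R : Subgroup G} (hN : N.Normal) (hR : R.Normal)
    {p : ℕ} (hc : p.Coprime (Nat.card N)) (hRp : IsPGroup p R) {x a : G} (hx : x ∈ N) (ha : a ∈ R) :
    x * a * x⁻¹ = a := by
  have h1 : x * a * x⁻¹ * a⁻¹ ∈ R := R.mul_mem (hR.conj_mem a ha x) (R.inv_mem ha)
  have h2 : x * a * x⁻¹ * a⁻¹ ∈ N := by
    have : x * a * x⁻¹ * a⁻¹ = x * (a * x⁻¹ * a⁻¹) := by group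
    rw [this]
    exact N.mul_mem hx (hN.conj_mem _ (N.inv_mem hx) a)
  obtain ⟨k, hk⟩ := pgroup_elt hRp h1
  have := eq_one_of_mem_coprime hc h2 hk
  exact mul_inv_eq_one.mp this

theorem conj_pow_of {G : Type*} [Group G] {x d : G} {n : ℕ} (h : x * d * x⁻¹ = d ^ n) (j : ℕ) :
    x ^ j * d * (x ^ j)⁻¹ = d ^ (n ^ j) := by
  induction j with
  | zero => simp
  | succ j ih =>
    have : x ^ (j + 1) * d * (x ^ (j + 1))⁻¹ = x * (x ^ j * d * (x ^ j)⁻¹) * x⁻¹ := by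
      rw [pow_succ']; group
    rw [this, ih, ← conj_pow, h, ← pow_mul, pow_succ']

theorem q_centr {G : Type*} [Group G] [Finite G] {q r : ℕ} (hq : q.Prime) (hr : r.Prime)
    (hrq : r < q) {R : Subgroup G} (hR : R.Normal) (hRp : IsPGroup r R) (hX : XP r G) {x : G} {k : ℕ}
    (hx : x ^ (q ^ k) = 1) : ∀ a ∈ R, x * a * x⁻¹ = a := by
  obtain ⟨N, M, hN, hNM, hc, hk, hor⟩ := hX
  have hcop : q.Coprime r := (Nat.coprime_primes hq hr).mpr hrq.ne'
  rcases hor with rfl | ⟨hi, hA⟩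
  · intro a ha
    obtain ⟨j, hj⟩ := hk x trivial
    have hxN : x ∈ N := mem_of_coprime_pow (Nat.Coprime.pow j k hcop.symm) hj hx
    exact comm_of_disjoint hN hR hc hRp hxN ha
  · have hMn : M.Normal := hA M hNM le_rfl
    have hRM : R ≤ M := by
      intro a ha
      obtain ⟨j, hj⟩ := pgroup_elt hRp ha
      exact mem_of_pelt hMn hi hj
    have hna : NormAll x R := fun A hAR a ha =>
      (normal_of_XP2 hN hc hNM hA hR hRp hRM hAR).conj_mem a ha x
    refine cop_fix hr hRp hx (hcop.pow_left k) hna ?_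
    intro d hd hdr
    by_cases hd1 : d = 1
    · simp [hd1]
    obtain ⟨n, hn⟩ := hna.pow hd
    have hnr : n.Coprime r := by
      rw [Nat.coprime_comm, hr.coprime_iff_not_dvd]
      rintro ⟨m, rfl⟩
      rw [pow_mul, hdr, one_pow] at hn
      exact hd1 (conj_eq_one_iff.mp hn)
    have h1 : x ^ (r - 1) * d * (x ^ (r - 1))⁻¹ = d := by
      rw [conj_pow_of hn]
      have := Nat.ModEq.pow_totient hnr
      rw [Nat.totient_prime hr] at this
      simpa using pow_eq_of_modEq hdr this
    have h2 : x ∈ Subgroup.centralizer {d} := by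
      refine mem_of_coprime_pow (m := r - 1) (n := q ^ k) ?_ ?_ hx
      · apply Nat.Coprime.pow_right
        exact Nat.Coprime.symm <| Nat.coprime_of_lt_prime (by have := hr.two_le; omega) (by omega) hq
      · rw [Subgroup.mem_centralizer_singleton_iff]
        exact mul_inv_eq_iff_eq_mul.mp h1
    rw [Subgroup.mem_centralizer_singleton_iff] at h2
    rw [h2]; group

theorem tower_aux (n : ℕ) : ∀ (G : Type u) [Group G] [Finite G], Group.IsSolvable G →
    Nat.card G = n → (∀ p : ℕ, p.Prime → XP p G) → ∀ q : ℕ, q.Prime →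
    (∀ r : ℕ, r.Prime → r ∣ Nat.card G → r ≤ q) → ∀ Q : Sylow q G, (Q : Subgroup G).Normal := by
  induction n using Nat.strong_induction_on with
  | _ n ih =>
  intro G _ _ hs hcard hX q hq hmax Q
  have : Fact q.Prime := ⟨hq⟩
  rcases subsingleton_or_nontrivial G with hsub | hnt
  · have : (Q : Subgroup G) = ⊥ := Subsingleton.elim _ _
    rw [this]; infer_instance
  obtain ⟨r, hr, R, hR, hRb, hRp⟩ := exists_normal_pgroup G
  have : Fact r.Prime := ⟨hr⟩
  have hsurj := QuotientGroup.mk'_surjective R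
  have hcq : Nat.card (G ⧸ R) < n := by
    rw [← hcard, Subgroup.card_eq_card_quotient_mul_card_subgroup R]
    have h1 : 1 < Nat.card R := by
      rw [Subgroup.one_lt_card_iff_ne_bot]; exact hRb
    have h2 : 0 < Nat.card (G ⧸ R) := Nat.card_pos
    nlinarith
  have hdvd : Nat.card (G ⧸ R) ∣ Nat.card G := Subgroup.card_quotient_dvd_card R
  have hQ' := ih _ hcq (G ⧸ R) inferInstance rfl (fun p hp => (hX p hp).map hp hsurj) q hq
    (fun s hs hd => hmax s hs (hd.trans hdvd)) (Q.mapSurjective hsurj)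
  have hrd : r ∣ Nat.card G := by
    obtain ⟨k, hk⟩ := IsPGroup.iff_card.mp hRp
    have : k ≠ 0 := by
      rintro rfl
      exact hRb (Subgroup.card_eq_one.mp (by simpa using hk))
    exact ((dvd_pow_self r this).trans hk.symm.dvd).trans (Subgroup.card_subgroup_dvd_card R)
  have hrq := hmax r hr hrd
  have hconj : ∀ x ∈ (Q : Subgroup G), ∀ g : G, ∃ y ∈ (Q : Subgroup G), ∃ a ∈ R, g * x * g⁻¹ = y * a := by
    intro x hx g
    have h1 := hQ'.conj_mem (QuotientGroup.mk' R x) (by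
      rw [Sylow.coe_mapSurjective]; exact Subgroup.mem_map_of_mem _ hx) (QuotientGroup.mk' R g)
    rw [Sylow.coe_mapSurjective] at h1
    obtain ⟨y, hy, hyx⟩ := h1
    refine ⟨y, hy, y⁻¹ * (g * x * g⁻¹), ?_, by group⟩
    rw [← QuotientGroup.eq]
    exact hyx
  constructor
  intro x hx g
  obtain ⟨y, hy, a, ha, e⟩ := hconj x hx g
  rcases hrq.eq_or_lt with rfl | hlt
  · rw [e]
    exact mul_mem hy (IsPGroup.le_sylow_of_normal hRp Q ha)
  · obtain ⟨k1, hk1⟩ := pgroup_elt Q.isPGroup' hy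
    obtain ⟨k2, hk2⟩ := pgroup_elt Q.isPGroup' hx
    obtain ⟨k3, hk3⟩ := pgroup_elt hRp ha
    have hc := q_centr hq hr hlt hR hRp (hX r hr) hk1 a ha
    have hcom : Commute y a := by
      rw [mul_inv_eq_iff_eq_mul] at hc; exact hc
    have : a ^ (q ^ (k1 + k2)) = 1 := by
      have h1 : (y * a) ^ (q ^ (k1 + k2)) = 1 := by
        rw [← e, conj_pow, pow_add, mul_comm, pow_mul, hk2]; simp
      rw [hcom.mul_pow] at h1
      rwa [pow_add q, pow_mul y, hk1, one_pow, one_mul, ← pow_add] at h1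
    have ha1 := one_of_coprime_pow (Nat.Coprime.pow (k1+k2) k3 ((Nat.coprime_primes hq hr).mpr hlt.ne')) this hk3
    rw [e, ha1, mul_one]; exact hy

theorem tower {G : Type*} [Group G] [Finite G] (hs : Group.IsSolvable G)
    (hX : ∀ p : ℕ, p.Prime → XP p G) {q : ℕ} (hq : q.Prime)
    (hm : ∀ r : ℕ, r.Prime → r ∣ Nat.card G → r ≤ q) (Q : Sylow q G) : (Q : Subgroup G).Normal :=
  tower_aux _ G hs rfl hX q hq hm Q

theorem isPGroup_of {G : Type*} [Group G] [Finite G] {p : ℕ} (hp : p.Prime)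
    (h : ∀ q : ℕ, q.Prime → q ≠ p → ∀ x : G, x ^ q = 1 → x = 1) : IsPGroup p G := by
  have : Fact p.Prime := ⟨hp⟩
  have h1 := Nat.eq_prime_pow_of_unique_prime_dvd (n := Nat.card G) (p := p) Nat.card_pos.ne' (by
    intro q hq hd
    by_contra hne
    have : Fact q.Prime := ⟨hq⟩
    obtain ⟨x, hx⟩ := exists_prime_orderOf_dvd_card' q hd
    have := h q hq hne x (by rw [← hx]; exact pow_orderOf_eq_one x)
    rw [this, orderOf_one] at hx
    exact hq.one_lt.ne hx)
  exact IsPGroup.of_card h1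

theorem top_of_sylows {G : Type*} [Group G] [Finite G] {H : Subgroup G}
    (h : ∀ r : ℕ, r.Prime → ∃ R : Sylow r G, (R : Subgroup G) ≤ H) : H = ⊤ := by
  rw [← Subgroup.index_eq_one]
  by_contra h1
  obtain ⟨r, hr, hd⟩ := Nat.exists_prime_and_dvd h1
  have : Fact r.Prime := ⟨hr⟩
  obtain ⟨R, hR⟩ := h r hr
  exact R.not_dvd_index (hd.trans (Subgroup.index_dvd_of_le hR))

theorem perm_of_le {G : Type*} [Group G] {R K : Subgroup G} (h : R ≤ K) :
    (K : Set G) * (R : Set G) = (R : Set G) * (K : Set G) := by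
  ext x
  constructor
  · rintro ⟨a, ha, b, hb, rfl⟩
    exact ⟨1, R.one_mem, a * b, K.mul_mem ha (h hb), by simp⟩
  · rintro ⟨a, ha, b, hb, rfl⟩
    exact ⟨a * b, K.mul_mem (h ha) hb, 1, R.one_mem, by simp⟩

theorem perm_of_normal {G : Type*} [Group G] {R K : Subgroup G} (h : K.Normal) :
    (K : Set G) * (R : Set G) = (R : Set G) * (K : Set G) := by
  ext x
  constructor
  · rintro ⟨a, ha, b, hb, rfl⟩
    exact ⟨b, hb, b⁻¹ * a * b, by simpa using h.conj_mem a ha b⁻¹, by simp [mul_assoc]⟩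
  · rintro ⟨a, ha, b, hb, rfl⟩
    exact ⟨a * b * a⁻¹, h.conj_mem b hb a, a, ha, by simp [mul_assoc]⟩

theorem pst_norm {G : Type*} [Group G] [Finite G] (hG : IsPST G) {p : ℕ} (hp : p.Prime)
    {N M A : Subgroup G} (hN : N.Normal) (hM : M.Normal)
    (hMN : ∀ x ∈ M, ∃ k : ℕ, x ^ (p ^ k) ∈ N) (hNA : N ≤ A) (hAM : A ≤ M) {q : ℕ} (hq : q.Prime)
    (hqp : q ≠ p) (Q : Sylow q G) {x a : G} (hx : x ∈ (Q : Subgroup G)) (ha : a ∈ A) :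
    x * a * x⁻¹ ∈ A := by
  have hel : ∀ r : ℕ, r.Prime → r ≠ p → ∀ y ∈ M, ∀ n : ℕ, y ^ (r ^ n) = 1 → y ∈ N := by
    intro r hr hrp y hy n hn
    obtain ⟨k, hk⟩ := hMN y hy
    exact mem_of_coprime_pow (Nat.Coprime.pow k n ((Nat.coprime_primes hp hr).mpr hrp.symm)) hk hn
  have hMs : SPermutable M := fun q hq Q => perm_of_normal hM
  have hKs : SPermutable (A.subgroupOf M) := by
    intro r hr R
    by_cases hrp : r = p
    · subst hrp
      have : Fact r.Prime := ⟨hr⟩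
      have hs := QuotientGroup.mk'_surjective (N.subgroupOf M)
      have htop : ⊤ = ((R.mapSurjective hs : Sylow r _) : Subgroup (M ⧸ N.subgroupOf M)) := by
        refine (R.mapSurjective hs).is_maximal' ?_ le_top
        rintro ⟨y, -⟩
        obtain ⟨y, rfl⟩ := hs y
        obtain ⟨k, hk⟩ := hMN y y.2
        refine ⟨k, ?_⟩
        ext
        simp only [Subgroup.coe_pow, Subgroup.coe_one]
        rw [← map_pow]
        rw [QuotientGroup.mk'_apply, QuotientGroup.eq_one_iff]
        exact hk
      have hdec : ∀ m : M, ∃ y ∈ (R : Subgroup M), y⁻¹ * m ∈ A.subgroupOf M := by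
        intro m
        have : QuotientGroup.mk' (N.subgroupOf M) m ∈ (⊤ : Subgroup (M ⧸ N.subgroupOf M)) := trivial
        rw [htop, Sylow.coe_mapSurjective] at this
        obtain ⟨y, hy, e⟩ := this
        refine ⟨y, hy, ?_⟩
        have := QuotientGroup.eq.mp e
        exact hNA this
      have h1 : ((R : Subgroup M) : Set M) * ((A.subgroupOf M : Subgroup M) : Set M) = Set.univ := by
        rw [Set.eq_univ_iff_forall]
        intro m
        obtain ⟨y, hy, h⟩ := hdec m
        exact ⟨y, hy, _, h, by simp⟩
      have h2 : ((A.subgroupOf M : Subgroup M) : Set M) * ((R : Subgroup M) : Set M) = Set.univ := by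
        rw [Set.eq_univ_iff_forall]
        intro m
        obtain ⟨y, hy, h⟩ := hdec m⁻¹
        exact ⟨m * y, by simpa using inv_mem h, y⁻¹, inv_mem hy, by simp⟩
      rw [h1, h2]
    · apply perm_of_le
      intro y hy
      obtain ⟨n, hn⟩ := pgroup_elt R.isPGroup' hy
      exact hNA (hel r hr hrp y y.2 n (by simpa [Subtype.ext_iff] using hn))
  have hA := hG M hMs _ hKs
  rw [Subgroup.map_subgroupOf_eq_of_le hAM] at hA
  have h1 : x * a ∈ (A : Set G) * ((Q : Subgroup G) : Set G) := by
    rw [hA q hq Q]; exact ⟨x, hx, a, ha, rfl⟩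
  obtain ⟨b, hb, y, hy, e⟩ := h1
  have e : b * y = x * a := e
  have e2 : x * a * x⁻¹ = b * (y * x⁻¹) := by rw [← e]; group
  have hyM : y * x⁻¹ ∈ M := by
    have : y * x⁻¹ = b⁻¹ * (x * a * x⁻¹) := by rw [e2]; group
    rw [this]
    exact M.mul_mem (M.inv_mem (hAM hb)) (hM.conj_mem a (hAM ha) x)
  obtain ⟨n, hn⟩ := pgroup_elt Q.isPGroup' (mul_mem hy (inv_mem hx))
  rw [e2]
  exact A.mul_mem hb (hNA (hel q hq hqp _ hyM n hn))

theorem pow_conj_one {G : Type*} [Group G] {d g : G} {p : ℕ} (h : d ^ p = 1) :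
    (g * d * g⁻¹) ^ p = 1 := by rw [conj_pow, h]; simp

theorem XP_of_act {G : Type*} [Group G] [Finite G] [Group.IsSolvable G] {p : ℕ} (hp : p.Prime)
    (hO : ∀ N : Subgroup G, N.Normal → p.Coprime (Nat.card N) → N = ⊥)
    (hact : ∀ F : Subgroup G, F.Normal → IsPGroup p F → ∀ q : ℕ, q.Prime → q ≠ p → ∀ x : G, ∀ n : ℕ,
      x ^ (q ^ n) = 1 → NormAll x F) : XP p G := by
  have : Fact p.Prime := ⟨hp⟩
  by_cases hG : IsPGroup p G
  · exact XP.of_pgroup hp hG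
  obtain ⟨P⟩ : Nonempty (Sylow p G) := inferInstance
  set F := (P : Subgroup G).normalCore with hFdef
  have hFn : F.Normal := inferInstance
  have hFP : F ≤ (P : Subgroup G) := Subgroup.normalCore_le _
  have hFp : IsPGroup p F := P.isPGroup'.to_le hFP
  have hFm : ∀ M : Subgroup G, M.Normal → IsPGroup p M → M ≤ F := by
    intro M hM hMp
    exact Subgroup.normal_le_normalCore.mpr (IsPGroup.le_sylow_of_normal hMp P)
  have hC := centralizer_core hp hO hFn hFm
  have hcentr : ∀ q : ℕ, q.Prime → q ≠ p → ∀ x : G, ∀ n : ℕ, x ^ (q ^ n) = 1 →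
      (∀ a ∈ F, x * a * x⁻¹ = a) → x = 1 := by
    intro q hq hqp x n hn h
    have hx : x ∈ F := by
      apply hC
      rw [Subgroup.mem_centralizer_iff]
      intro a ha
      exact (mul_inv_eq_iff_eq_mul.mp (h a ha)).symm
    obtain ⟨k, hk⟩ := pgroup_elt hFp hx
    exact one_of_coprime_pow (Nat.Coprime.pow n k ((Nat.coprime_primes hq hp).mpr hqp)) hn hk
  let D := Subgroup.centralizer {d : G | d ∈ F ∧ d ^ p = 1}
  have hDn : D.Normal := by
    constructor
    intro z hz g
    rw [Subgroup.mem_centralizer_iff] at hz ⊢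
    rintro d ⟨hd, hdp⟩
    have := hz (g⁻¹ * d * g⁻¹⁻¹) ⟨hFn.conj_mem d hd g⁻¹, pow_conj_one hdp⟩
    calc d * (g * z * g⁻¹) = g * ((g⁻¹ * d * g⁻¹⁻¹) * z) * g⁻¹ := by group
      _ = g * (z * (g⁻¹ * d * g⁻¹⁻¹)) * g⁻¹ := by rw [this]
      _ = _ := by group
  have hDp : IsPGroup p D := by
    apply isPGroup_of hp
    rintro q hq hqp ⟨x, hx⟩ hxq
    have hxq' : x ^ (q ^ 1) = 1 := by simpa [Subtype.ext_iff] using hxq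
    ext
    refine hcentr q hq hqp x 1 hxq' ?_
    refine cop_fix hp hFp hxq' (((Nat.coprime_primes hq hp).mpr hqp).pow_left 1)
      (hact F hFn hFp q hq hqp x 1 hxq') ?_
    intro a ha hap
    rw [Subgroup.mem_centralizer_iff] at hx
    rw [← hx a ⟨ha, hap⟩]; group
  have hDP : D ≤ (P : Subgroup G) := (hFm D hDn hDp).trans hFP
  have hnorm : ∀ q : ℕ, q.Prime → q ≠ p → ∀ x : G, ∀ n : ℕ, x ^ (q ^ n) = 1 →
      ∀ g ∈ (P : Subgroup G), x * g * x⁻¹ ∈ (P : Subgroup G) := by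
    intro q hq hqp x n hn g hg
    obtain ⟨l, hl⟩ := uni_scalar hp hFp (hact F hFn hFp q hq hqp x n hn)
    have hc : x * g * x⁻¹ * g⁻¹ ∈ D := by
      rw [Subgroup.mem_centralizer_iff]
      rintro d ⟨hd, hdp⟩
      have hf : x⁻¹ * (g⁻¹ * d * g⁻¹⁻¹) * x⁻¹⁻¹ ∈ F := hFn.conj_mem _ (hFn.conj_mem d hd _) _
      have hfp : (x⁻¹ * (g⁻¹ * d * g⁻¹⁻¹) * x⁻¹⁻¹) ^ p = 1 := pow_conj_one (pow_conj_one hdp)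
      set f := x⁻¹ * (g⁻¹ * d * g⁻¹⁻¹) * x⁻¹⁻¹ with hfd
      have h1 := hl f hf hfp
      have h2 := hl (g * f * g⁻¹) (hFn.conj_mem f hf g) (pow_conj_one hfp)
      rw [conj_pow, ← h1] at h2
      have h3 : g * (x * f * x⁻¹) * g⁻¹ = d := by rw [hfd]; group
      rw [h3] at h2
      have h4 : x * g * x⁻¹ * g⁻¹ * d = x * (g * f * g⁻¹) * x⁻¹ * (x * g * x⁻¹ * g⁻¹) := by
        rw [hfd]; group
      rw [h4, h2]
    have : x * g * x⁻¹ = (x * g * x⁻¹ * g⁻¹) * g := by group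
    rw [this]
    exact mul_mem (hDP hc) hg
  have hnorm' : ∀ A : Subgroup G, (∀ q : ℕ, q.Prime → q ≠ p → ∀ x : G, ∀ n : ℕ, x ^ (q ^ n) = 1 →
      ∀ g ∈ A, x * g * x⁻¹ ∈ A) → (P : Subgroup G) ≤ Subgroup.normalizer (A : Set G) → A.Normal := by
    intro A h hPA
    rw [← Subgroup.normalizer_eq_top_iff]
    apply top_of_sylows
    intro r hr
    by_cases hrp : r = p
    · subst hrp; exact ⟨P, hPA⟩
    · obtain ⟨R⟩ : Nonempty (Sylow r G) := inferInstance
      refine ⟨R, fun x hx => ?_⟩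
      obtain ⟨n, hn⟩ := pgroup_elt R.isPGroup' hx
      rw [Subgroup.mem_normalizer_iff]
      intro g
      refine ⟨h r hr hrp x n hn g, fun hg => ?_⟩
      have := h r hr hrp x⁻¹ n (by rw [inv_pow, hn, inv_one]) _ hg
      simpa [mul_assoc] using this
  have hPn : (P : Subgroup G).Normal := hnorm' _ hnorm Subgroup.le_normalizer
  have hPF : (P : Subgroup G) ≤ F := hFm _ hPn P.isPGroup'
  have hFP' : F = P := le_antisymm hFP hPF
  obtain ⟨q, hq, hqp, x, hxq, hx1⟩ : ∃ q : ℕ, q.Prime ∧ q ≠ p ∧ ∃ x : G, x ^ q = 1 ∧ x ≠ 1 := by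
    by_contra hcon
    push Not at hcon
    exact hG (isPGroup_of hp hcon)
  have hxq' : x ^ (q ^ 1) = 1 := by simpa using hxq
  have hab := abelian_of_act hp hFp hxq' (((Nat.coprime_primes hq hp).mpr hqp).pow_left 1)
      (hact F hFn hFp q hq hqp x 1 hxq') (fun h => hx1 (hcentr q hq hqp x 1 hxq' h))
  refine ⟨⊥, F, inferInstance, bot_le, by simp, ?_, Or.inr ⟨?_, ?_⟩⟩
  · intro x hx
    obtain ⟨k, hk⟩ := pgroup_elt hFp hx
    exact ⟨k, hk⟩
  · rw [hFP', Nat.coprime_comm, hp.coprime_iff_not_dvd]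
    exact P.not_dvd_index
  · intro A _ hAF
    refine hnorm' A (fun q hq hqp x n hn => hact F hFn hFp q hq hqp x n hn A hAF) ?_
    intro x hx
    rw [Subgroup.mem_normalizer_iff]
    intro g
    have hxF := hPF hx
    constructor
    · intro hg
      rw [hab x hxF g (hAF hg)]; simpa using hg
    · intro hg
      have h1 := hab x hxF _ (hAF hg)
      have h2 : g = x * g * x⁻¹ := by
        have : x * g = x * g * x⁻¹ * x := by group
        rw [← h1] at this
        exact mul_left_cancel this
      rw [h2]; exact hg

theorem XP_of_PST {G : Type*} [Group G] [Finite G] (hs : Group.IsSolvable G) (hG : IsPST G) {p : ℕ}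
    (hp : p.Prime) : XP p G := by
  obtain ⟨N, hN, hc, hB⟩ := exists_core G p
  apply XP.lift N hc
  have hsurj := QuotientGroup.mk'_surjective N
  apply XP_of_act hp hB
  intro F hF hFp q hq hqp x n hn A hAF a ha
  have : Fact q.Prime := ⟨hq⟩
  obtain ⟨Q, hQ⟩ := pelt_mem_sylow hn
  obtain ⟨Q, rfl⟩ := Sylow.mapSurjective_surjective hsurj q Q
  rw [Sylow.coe_mapSurjective] at hQ
  obtain ⟨x, hx, rfl⟩ := hQ
  obtain ⟨a, rfl⟩ := hsurj a
  have hker : ∀ B : Subgroup (G ⧸ N), N ≤ B.comap (QuotientGroup.mk' N) := by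
    intro B
    have := MonoidHom.ker_le_comap (QuotientGroup.mk' N) B
    rwa [QuotientGroup.ker_mk'] at this
  have := pst_norm hG hp (N := N) (M := F.comap (QuotientGroup.mk' N))
    (A := A.comap (QuotientGroup.mk' N)) hN (hF.comap _) ?_ (hker A) (Subgroup.comap_mono hAF) hq hqp Q
    hx ha
  · simpa using this
  · intro y hy
    obtain ⟨k, hk⟩ := pgroup_elt hFp hy
    refine ⟨k, ?_⟩
    rw [← map_pow] at hk
    exact (QuotientGroup.eq_one_iff _).mp hk

def HYP (G : Type*) [Group G] : Prop :=
  ∀ q : ℕ, q.Prime → ∀ Z : Subgroup G, q ∣ Z.index → ∃ T : Subgroup G, Group.IsSolvable T ∧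
    (∀ p : ℕ, p.Prime → XP p T) ∧ (∃ k : ℕ, T.index = q ^ k) ∧ ∃ t ∈ T, t ∉ Z ∧ ∃ n : ℕ, t ^ (q ^ n) = 1

theorem HYP.map {G G' : Type*} [Group G] [Finite G] [Group G'] {f : G →* G'}
    (hf : Function.Surjective f) (h : HYP G) : HYP G' := by
  intro q hq Z hZ
  obtain ⟨T, hT, hX, ⟨k, hk⟩, t, htT, htZ, n, hn⟩ := h q hq (Z.comap f)
    (by rw [Subgroup.index_comap_of_surjective _ hf]; exact hZ)
  have hs := f.subgroupMap_surjective T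
  refine ⟨T.map f, Group.isSolvable_of_surjective hs, fun p hp => (hX p hp).map hp hs, ?_,
    f t, Subgroup.mem_map_of_mem f htT, htZ, n, by rw [← map_pow, hn, map_one]⟩
  have := T.index_map_dvd hf
  rw [hk] at this
  obtain ⟨j, -, hj⟩ := (Nat.dvd_prime_pow hq).mp this
  exact ⟨j, hj⟩

theorem index_of_mul {G : Type*} [Group G] [Finite G] {W T : Subgroup G}
    (h : (W : Set G) * (T : Set G) = Set.univ) : T.index ∣ Nat.card W := by
  have h1 : MulAction.orbit W ((1 : G) : G ⧸ T) = Set.univ := by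
    rw [Set.eq_univ_iff_forall]
    intro x
    obtain ⟨x, rfl⟩ := QuotientGroup.mk_surjective x
    have : x ∈ (W : Set G) * (T : Set G) := by rw [h]; trivial
    obtain ⟨w, hw, t, ht, e⟩ := this
    refine ⟨⟨w, hw⟩, ?_⟩
    have e : w * t = x := e
    change ((w * 1 : G) : G ⧸ T) = _
    rw [QuotientGroup.eq, ← e]
    simpa using ht
  have h2 := MulAction.index_stabilizer W ((1 : G) : G ⧸ T)
  rw [h1, Set.ncard_univ] at h2
  have h3 : T.index = Nat.card (G ⧸ T) := rfl
  rw [h3, ← h2]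
  exact Subgroup.index_dvd_card _

theorem mul_of_coprime {G : Type*} [Group G] [Finite G] {S T : Subgroup G}
    (h : S.index.Coprime T.index) (x : G) : ∃ s ∈ S, ∃ t ∈ T, x = s * t := by
  have h1 := Subgroup.relIndex_mul_index (inf_le_left : S ⊓ T ≤ S)
  have h2 : T.index ∣ (S ⊓ T).index := Subgroup.index_dvd_of_le inf_le_right
  rw [← h1] at h2
  have h3 := h.symm.dvd_of_dvd_mul_right h2
  rw [Subgroup.inf_relIndex_left] at h3
  have h4 : MulAction.stabilizer S ((1 : G) : G ⧸ T) = T.subgroupOf S := by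
    ext s
    rw [MulAction.mem_stabilizer_iff, Subgroup.mem_subgroupOf]
    change ((s * 1 : G) : G ⧸ T) = _ ↔ _
    rw [QuotientGroup.eq]
    simp
  have h5 := MulAction.index_stabilizer S ((1 : G) : G ⧸ T)
  rw [h4] at h5
  have h6 : MulAction.orbit S ((1 : G) : G ⧸ T) = Set.univ := by
    rw [Set.eq_univ_iff_ncard]
    apply le_antisymm
    · exact Set.ncard_le_card _
    · rw [← h5]
      exact Nat.le_of_dvd (Nat.pos_of_ne_zero Subgroup.index_ne_zero_of_finite) h3
  have h7 : (x : G ⧸ T) ∈ MulAction.orbit S ((1 : G) : G ⧸ T) := by rw [h6]; trivial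
  obtain ⟨s, hs⟩ := h7
  have hs : ((s * 1 : G) : G ⧸ T) = x := hs
  rw [QuotientGroup.eq] at hs
  exact ⟨s, s.2, (s : G)⁻¹ * x, by simpa using hs, by group⟩

theorem exists_max_prime (G : Type*) [Group G] [Finite G] [Nontrivial G] :
    ∃ q : ℕ, q.Prime ∧ q ∣ Nat.card G ∧ ∀ r : ℕ, r.Prime → r ∣ Nat.card G → r ≤ q := by
  have h0 : Nat.card G ≠ 0 := Nat.card_pos.ne'
  have h1 : (Nat.card G).primeFactors.Nonempty := by
    rw [Nat.nonempty_primeFactors]; exact Finite.one_lt_card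
  obtain ⟨q, hq, hm⟩ := Finset.exists_max_image _ id h1
  refine ⟨q, Nat.prime_of_mem_primeFactors hq, Nat.dvd_of_mem_primeFactors hq, fun r hr hd => ?_⟩
  exact hm r (Nat.mem_primeFactors.mpr ⟨hr, hd, h0⟩)

theorem exists_sylow_le {G : Type*} [Group G] [Finite G] {q : ℕ} (hq : q.Prime) {T : Subgroup G}
    (h : q.Coprime T.index) : ∃ R : Sylow q G, (R : Subgroup G) ≤ T := by
  have : Fact q.Prime := ⟨hq⟩
  obtain ⟨B⟩ : Nonempty (Sylow q T) := inferInstance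
  refine ⟨IsPGroup.toSylow (P := (B : Subgroup T).map T.subtype) (B.isPGroup'.map _) ?_, ?_⟩
  · rw [Subgroup.index_map_subtype, hq.dvd_mul, not_or]
    exact ⟨B.not_dvd_index, (hq.coprime_iff_not_dvd).mp h⟩
  · rw [IsPGroup.toSylow_coe]
    exact Subgroup.map_subtype_le _

theorem solvable_of_HYP_aux (n : ℕ) : ∀ (G : Type u) [Group G] [Finite G], Nat.card G = n →
    HYP G → Group.IsSolvable G := by
  induction n using Nat.strong_induction_on with
  | _ n ih =>
  intro G _ _ hcard hG
  rcases subsingleton_or_nontrivial G with hsub | hnt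
  · infer_instance
  obtain ⟨q, hq, hqd, hmax⟩ := exists_max_prime G
  have : Fact q.Prime := ⟨hq⟩
  by_cases hGp : IsPGroup q G
  · have := hGp.isNilpotent
    infer_instance
  obtain ⟨p, hp, hpq, y, hy, hy1⟩ : ∃ p : ℕ, p.Prime ∧ p ≠ q ∧ ∃ x : G, x ^ p = 1 ∧ x ≠ 1 := by
    by_contra hcon
    push Not at hcon
    exact hGp (isPGroup_of hq hcon)
  have : Fact p.Prime := ⟨hp⟩
  have hpd : p ∣ Nat.card G := by
    rw [← orderOf_eq_prime hy hy1]; exact orderOf_dvd_natCard y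
  obtain ⟨T, hT, hTX, ⟨k, hk⟩, t, htT, ht1, m, hm⟩ := hG q hq ⊥ (by simpa using hqd)
  obtain ⟨S, hS, -, ⟨j, hj⟩, -⟩ := hG p hp ⊥ (by simpa using hpd)
  obtain ⟨A, hA⟩ := pelt_mem_sylow (q := q) (x := (⟨t, htT⟩ : T)) (n := m) (by ext; simpa using hm)
  have hAn := tower hT hTX hq (fun r hr hd => hmax r hr (hd.trans (Subgroup.card_subgroup_dvd_card T))) A
  have hcop : q.Coprime p := (Nat.coprime_primes hq hp).mpr hpq.symm
  obtain ⟨B, hB⟩ := exists_sylow_le hq (T := S) (by rw [hj]; exact hcop.pow_right j)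
  obtain ⟨R, hR⟩ := (A.isPGroup'.map T.subtype : IsPGroup q ((A : Subgroup T).map T.subtype)).exists_le_sylow
  obtain ⟨g, hg⟩ := MulAction.exists_smul_eq G B R
  have hAS : ∀ a ∈ (A : Subgroup T), g⁻¹ * (a : G) * g ∈ S := by
    intro a ha
    have h1 : (a : G) ∈ (R : Subgroup G) := hR ⟨a, ha, rfl⟩
    rw [← hg, Sylow.coe_subgroup_smul, Subgroup.mem_pointwise_smul_iff_inv_smul_mem] at h1
    have := hB h1
    simpa using this
  let S' : Subgroup G := S.map (MulAut.conj g).toMonoidHom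
  have hSmem : ∀ x : G, g⁻¹ * x * g ∈ S → x ∈ S' := by
    intro x hx
    exact ⟨_, hx, by simp [mul_assoc]⟩
  have hS'i : S'.index ∣ p ^ j := by
    rw [← hj]; exact S.index_map_dvd (MulAut.conj g).surjective
  have hS's : Group.IsSolvable S' :=
    Group.isSolvable_of_surjective (MonoidHom.subgroupMap_surjective (MulAut.conj g).toMonoidHom S)
  have hcoi : S'.index.Coprime T.index := by
    rw [hk]
    exact Nat.Coprime.coprime_dvd_left hS'i (Nat.Coprime.pow j k hcop.symm)
  have hN : Subgroup.normalClosure {t} ≤ S' := by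
    rw [Subgroup.normalClosure, Subgroup.closure_le]
    intro x hx
    rw [Group.mem_conjugatesOfSet_iff] at hx
    obtain ⟨a, rfl, hc⟩ := hx
    obtain ⟨h, rfl⟩ := isConj_iff.mp hc
    obtain ⟨s, hs, v, hv, rfl⟩ := mul_of_coprime hcoi h
    have h1 := hAS _ (hAn.conj_mem _ hA ⟨v, hv⟩)
    have h2 := hSmem _ h1
    have h3 := S'.mul_mem (S'.mul_mem hs h2) (S'.inv_mem hs)
    simpa [mul_assoc] using h3
  set N := Subgroup.normalClosure {t} with hNd
  have htN : t ∈ N := Subgroup.subset_normalClosure rfl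
  have hNb : N ≠ ⊥ := by
    intro h
    rw [h] at htN
    exact ht1 htN
  have hNs : Group.IsSolvable N :=
    Group.isSolvable_of_isSolvable_injective (Subgroup.inclusion_injective hN)
  have hcq : Nat.card (G ⧸ N) < n := by
    rw [← hcard, Subgroup.card_eq_card_quotient_mul_card_subgroup N]
    have h1 : 1 < Nat.card N := by
      rw [Subgroup.one_lt_card_iff_ne_bot]; exact hNb
    have h2 : 0 < Nat.card (G ⧸ N) := Nat.card_pos
    nlinarith
  have hq := ih _ hcq (G ⧸ N) rfl (hG.map (QuotientGroup.mk'_surjective N))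
  exact (Group.isSolvable_iff_subgroup_quotient N).mpr ⟨hNs, hq⟩

theorem solvable_of_HYP {G : Type*} [Group G] [Finite G] (h : HYP G) : Group.IsSolvable G :=
  solvable_of_HYP_aux _ G rfl h

theorem XP_of_HYP_core {G : Type*} [Group G] [Finite G] [Group.IsSolvable G] (hG : HYP G)
    {p : ℕ} (hp : p.Prime)
    (hO : ∀ N : Subgroup G, N.Normal → p.Coprime (Nat.card N) → N = ⊥) : XP p G := by
  have : Fact p.Prime := ⟨hp⟩
  by_cases hGp : IsPGroup p G
  · exact XP.of_pgroup hp hGp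
  obtain ⟨P⟩ : Nonempty (Sylow p G) := inferInstance
  set F := (P : Subgroup G).normalCore with hFdef
  have hFn : F.Normal := inferInstance
  have hFP : F ≤ (P : Subgroup G) := Subgroup.normalCore_le _
  have hFp : IsPGroup p F := P.isPGroup'.to_le hFP
  have hFm : ∀ M : Subgroup G, M.Normal → IsPGroup p M → M ≤ F := by
    intro M hM hMp
    exact Subgroup.normal_le_normalCore.mpr (IsPGroup.le_sylow_of_normal hMp P)
  have hC := centralizer_core hp hO hFn hFm
  have key : ∀ q : ℕ, q.Prime → q ≠ p → ∀ T : Subgroup G, XP p T → (∃ k : ℕ, T.index = q ^ k) →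
      ∀ t ∈ T, t ≠ 1 → ∀ n : ℕ, t ^ (q ^ n) = 1 →
      F.index.Coprime p ∧ F ≤ T ∧ ∀ g ∈ T, NormAll g F := by
    rintro q hq hqp T ⟨N, M, hN, hNM, hc, hk, hor⟩ ⟨k, hTk⟩ t htT ht1 n hn
    have hcop : q.Coprime p := (Nat.coprime_primes hq hp).mpr hqp
    obtain ⟨R, hR⟩ := exists_sylow_le hp (T := T) (by rw [hTk]; exact hcop.symm.pow_right k)
    have hFT : F ≤ T := (IsPGroup.le_sylow_of_normal hFp R).trans hR
    have hF'n : (F.subgroupOf T).Normal := hFn.subgroupOf T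
    have hF'p : IsPGroup p (F.subgroupOf T) := hFp.comap_subtype
    have hNF : ∀ x ∈ N, x = 1 := by
      intro x hx
      have hxF : (x : G) ∈ F := by
        apply hC
        rw [Subgroup.mem_centralizer_iff]
        intro a ha
        have := comm_of_disjoint hN hF'n hc hF'p (a := ⟨a, hFT ha⟩) hx ha
        have := congrArg Subtype.val (mul_inv_eq_iff_eq_mul.mp this)
        exact this.symm
      obtain ⟨k, hk⟩ := pgroup_elt hFp hxF
      exact eq_one_of_mem_coprime hc hx (by ext; simpa using hk)
    have hMel : ∀ x ∈ M, ∃ k : ℕ, x ^ (p ^ k) = 1 := by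
      intro x hx
      obtain ⟨k, hk⟩ := hk x hx
      exact ⟨k, hNF _ hk⟩
    have hNA : ∀ A : Subgroup T, N ≤ A := by
      intro A x hx
      rw [hNF x hx]; exact A.one_mem
    rcases hor with rfl | ⟨hi, hA⟩
    · exfalso
      obtain ⟨j, hj⟩ := hMel ⟨t, htT⟩ trivial
      exact ht1 (one_of_coprime_pow (Nat.Coprime.pow n j hcop) hn (congrArg Subtype.val hj))
    have hMn := hA M hNM le_rfl
    have hFM : F.subgroupOf T ≤ M := by
      intro x hx
      obtain ⟨j, hj⟩ := pgroup_elt hF'p hx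
      exact mem_of_pelt hMn hi hj
    have hMp : IsPGroup p M := by
      rintro ⟨x, hx⟩
      obtain ⟨k, hk⟩ := hMel x hx
      exact ⟨k, by ext; simpa using congrArg Subtype.val hk⟩
    have hab := abelian_of_act hp hMp (x := (⟨t, htT⟩ : T)) (m := q ^ n) (by ext; simpa using hn)
      (hcop.pow_left n) (fun A hAM a ha => (hA A (hNA A) hAM).conj_mem a ha _) (by
        intro h
        have htF : t ∈ F := by
          apply hC
          rw [Subgroup.mem_centralizer_iff]
          intro a ha
          have := h ⟨a, hFT ha⟩ (hFM ha)
          exact (congrArg Subtype.val (mul_inv_eq_iff_eq_mul.mp this)).symm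
        obtain ⟨j, hj⟩ := pgroup_elt hFp htF
        exact ht1 (one_of_coprime_pow (Nat.Coprime.pow n j hcop) hn hj))
    have hMF : M.map T.subtype ≤ F := by
      rintro _ ⟨x, hx, rfl⟩
      apply hC
      rw [Subgroup.mem_centralizer_iff]
      intro a ha
      have := hab ⟨a, hFT ha⟩ (hFM ha) x hx
      exact congrArg Subtype.val this
    refine ⟨?_, hFT, ?_⟩
    · refine Nat.Coprime.coprime_dvd_left (Subgroup.index_dvd_of_le hMF) ?_
      rw [Subgroup.index_map_subtype, hTk]
      exact Nat.Coprime.mul_left hi (hcop.pow_left k)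
    · intro g hg A hAF a ha
      have h1 : A.subgroupOf T ≤ M := fun x hx => hFM (hAF hx)
      exact (hA _ (hNA _) h1).conj_mem ⟨a, hFT (hAF ha)⟩ ha ⟨g, hg⟩
  obtain ⟨q, hq, hqp, x, hxq, hx1⟩ : ∃ q : ℕ, q.Prime ∧ q ≠ p ∧ ∃ x : G, x ^ q = 1 ∧ x ≠ 1 := by
    by_contra hcon
    push Not at hcon
    exact hGp (isPGroup_of hp hcon)
  have : Fact q.Prime := ⟨hq⟩
  have hqd : q ∣ Nat.card G := by
    rw [← orderOf_eq_prime hxq hx1]; exact orderOf_dvd_natCard x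
  let Z : Subgroup G := ⨅ A : {A : Subgroup G // A ≤ F}, Subgroup.normalizer ((A : Subgroup G) : Set G)
  have hZT : ∀ T : Subgroup G, (∀ g ∈ T, NormAll g F) → T ≤ Z := by
    intro T hT g hg
    rw [Subgroup.mem_iInf]
    rintro ⟨A, hA⟩
    rw [Subgroup.mem_normalizer_iff]
    intro a
    refine ⟨hT g hg A hA a, fun h => ?_⟩
    have := hT g⁻¹ (T.inv_mem hg) A hA _ h
    simpa [mul_assoc] using this
  obtain ⟨hFi, hFZ⟩ : F.index.Coprime p ∧ F ≤ Z := by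
    obtain ⟨T, -, hTX, hTi, t, htT, ht1, m, hm⟩ := hG q hq ⊥ (by simpa using hqd)
    obtain ⟨h1, h2, h3⟩ := key q hq hqp T (hTX p hp) hTi t htT (by simpa using ht1) m hm
    exact ⟨h1, h2.trans (hZT T h3)⟩
  have hZ : Z = ⊤ := by
    rw [← Subgroup.index_eq_one]
    by_contra h1
    obtain ⟨r, hr, hd⟩ := Nat.exists_prime_and_dvd h1
    have hrp : r ≠ p := by
      rintro rfl
      have := hd.trans (Subgroup.index_dvd_of_le hFZ)
      exact (hr.coprime_iff_not_dvd.mp hFi.symm) this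
    obtain ⟨T, -, hTX, hTi, t, htT, htZ, m, hm⟩ := hG r hr Z hd
    obtain ⟨-, -, h3⟩ := key r hr hrp T (hTX p hp) hTi t htT (fun h => htZ (h ▸ Z.one_mem)) m hm
    exact htZ (hZT T h3 htT)
  refine ⟨⊥, F, inferInstance, bot_le, by simp, ?_, Or.inr ⟨hFi, ?_⟩⟩
  · intro x hx
    obtain ⟨k, hk⟩ := pgroup_elt hFp hx
    exact ⟨k, hk⟩
  · intro A _ hAF
    rw [← Subgroup.normalizer_eq_top_iff, eq_top_iff, ← hZ]
    exact iInf_le (fun A : {A : Subgroup G // A ≤ F} => Subgroup.normalizer ((A : Subgroup G) : Set G)) ⟨A, hAF⟩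

theorem XP_of_HYP {G : Type*} [Group G] [Finite G] (hs : Group.IsSolvable G) (hG : HYP G) {p : ℕ}
    (hp : p.Prime) : XP p G := by
  obtain ⟨N, hN, hc, hB⟩ := exists_core G p
  apply XP.lift N hc
  exact XP_of_HYP_core (hG.map (QuotientGroup.mk'_surjective N)) hp hB

theorem HYP_of_supp {G : Type*} [Group G] [Finite G]
    (h : ∀ p : ℕ, p.Prime → p ∣ Nat.card G →
        ∀ (P : Sylow p G) (V : Subgroup G), V < ↑P →
          (∀ W : Subgroup G, V < W → W ≤ ↑P → W = ↑P) →
          ∃ T : Subgroup G, (V : Set G) * (T : Set G) = Set.univ ∧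
            IsSolvable ↥T ∧ IsPST ↥T) : HYP G := by
  intro q hq Z hZ
  have : Fact q.Prime := ⟨hq⟩
  obtain ⟨Q⟩ : Nonempty (Sylow q G) := inferInstance
  have hQZ : ¬ (Q : Subgroup G) ≤ Z := fun hle =>
    Q.not_dvd_index (hZ.trans (Subgroup.index_dvd_of_le hle))
  have hlt : (Q : Subgroup G) ⊓ Z < Q := lt_of_le_of_ne inf_le_left (fun e => hQZ (inf_eq_left.mp e))
  obtain ⟨W, ⟨⟨hW1, hW2⟩, hWm⟩⟩ := (Set.toFinite {W : Subgroup G | (Q : Subgroup G) ⊓ Z ≤ W ∧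
    W < (Q : Subgroup G)}).exists_maximal ⟨_, le_rfl, hlt⟩
  obtain ⟨T, hT, hTs, hTP⟩ := h q hq (hZ.trans Z.index_dvd_card) Q W hW2 (by
    intro U hWU hUQ
    by_contra hne
    exact hWU.not_ge (hWm ⟨hW1.trans hWU.le, lt_of_le_of_ne hUQ hne⟩ hWU.le))
  refine ⟨T, hTs, fun p hp => XP_of_PST hTs hTP hp, ?_, ?_⟩
  · obtain ⟨k, hk⟩ := IsPGroup.iff_card.mp (Q.isPGroup'.to_le hW2.le)
    have := index_of_mul hT
    rw [hk] at this
    obtain ⟨j, -, hj⟩ := (Nat.dvd_prime_pow hq).mp this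
    exact ⟨j, hj⟩
  · obtain ⟨y, hyQ, hyW⟩ := SetLike.exists_of_lt hW2
    have : y ∈ (W : Set G) * (T : Set G) := by rw [hT]; trivial
    obtain ⟨w, hw, t, ht, e⟩ := this
    have e : w * t = y := e
    have htQ : t ∈ (Q : Subgroup G) := by
      have : t = w⁻¹ * y := by rw [← e]; group
      rw [this]
      exact mul_mem (inv_mem (hW2.le hw)) hyQ
    refine ⟨t, ht, fun htZ => hyW ?_, pgroup_elt Q.isPGroup' htQ⟩
    rw [← e]
    exact W.mul_mem hw (hW1 ⟨htQ, htZ⟩)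

theorem SPermutable.map {G G' : Type*} [Group G] [Finite G] [Group G'] {f : G →* G'}
    (hf : Function.Surjective f) {A : Subgroup G} (h : SPermutable A) : SPermutable (A.map f) := by
  intro q hq Q
  have : Fact q.Prime := ⟨hq⟩
  obtain ⟨Q, rfl⟩ := Sylow.mapSurjective_surjective hf q Q
  rw [Sylow.coe_mapSurjective, Subgroup.coe_map, Subgroup.coe_map, ← Set.image_mul, ← Set.image_mul,
    h q hq Q]

theorem comm_mem {G : Type*} [Group G] [Finite G] {q r : ℕ} (hq : q.Prime) (hr : r.Prime)
    (hqr : r ≠ q) {Q A : Subgroup G} (hQ : Q.Normal) (hQp : IsPGroup q Q) (hA : SPermutable A) {h a : G}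
    {n : ℕ} (hh : h ∈ A) (hn : h ^ (r ^ n) = 1) (ha : a ∈ Q) : a⁻¹ * h * a * h⁻¹ ∈ A := by
  have : Fact q.Prime := ⟨hq⟩
  have : Fact r.Prime := ⟨hr⟩
  obtain ⟨S, hS⟩ := pelt_mem_sylow hn
  let S' : Sylow r G := a⁻¹ • S
  have hP := hA r hr S'
  have h1 : a⁻¹ * h * a ∈ (S' : Subgroup G) := by
    rw [Sylow.coe_subgroup_smul, Subgroup.mem_pointwise_smul_iff_inv_smul_mem]
    simpa [mul_assoc] using hS
  let B : Subgroup G :=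
    { carrier := (A : Set G) * ((S' : Subgroup G) : Set G)
      one_mem' := ⟨1, A.one_mem, 1, one_mem _, by simp⟩
      mul_mem' := by
        rintro _ _ ⟨a1, ha1, s1, hs1, rfl⟩ ⟨a2, ha2, s2, hs2, rfl⟩
        have : s1 * a2 ∈ (A : Set G) * ((S' : Subgroup G) : Set G) := by
          rw [hP]; exact ⟨s1, hs1, a2, ha2, rfl⟩
        obtain ⟨a3, ha3, s3, hs3, e⟩ := this
        have e : a3 * s3 = s1 * a2 := e
        refine ⟨a1 * a3, A.mul_mem ha1 ha3, s3 * s2, mul_mem hs3 hs2, ?_⟩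
        change a1 * a3 * (s3 * s2) = a1 * s1 * (a2 * s2)
        calc a1 * a3 * (s3 * s2) = a1 * (a3 * s3) * s2 := by group
          _ = a1 * (s1 * a2) * s2 := by rw [e]
          _ = _ := by group
      inv_mem' := by
        rintro _ ⟨a1, ha1, s1, hs1, rfl⟩
        rw [hP]
        exact ⟨s1⁻¹, inv_mem hs1, a1⁻¹, A.inv_mem ha1, by simp⟩ }
  have hBA : A ≤ B := fun x hx => ⟨x, hx, 1, one_mem _, by simp⟩
  have hBS : (S' : Subgroup G) ≤ B := fun x hx => ⟨1, A.one_mem, x, hx, by simp⟩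
  have hmul : (((S' : Subgroup G).subgroupOf B : Subgroup B) : Set B) * ((A.subgroupOf B : Subgroup B) : Set B)
      = Set.univ := by
    rw [Set.eq_univ_iff_forall]
    rintro ⟨x, hx⟩
    have hx' : x ∈ (A : Set G) * ((S' : Subgroup G) : Set G) := hx
    rw [hP] at hx'
    obtain ⟨s, hs, b, hb, e⟩ := hx'
    exact ⟨⟨s, hBS hs⟩, hs, ⟨b, hBA hb⟩, hb, Subtype.ext e⟩
  have hi := index_of_mul hmul
  have hSp : IsPGroup r ((S' : Subgroup G).subgroupOf B) := S'.isPGroup'.comap_subtype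
  obtain ⟨k, hk⟩ := IsPGroup.iff_card.mp hSp
  rw [hk] at hi
  have hNp : IsPGroup q (Q.subgroupOf B) := hQp.comap_subtype
  have hNn : (Q.subgroupOf B).Normal := hQ.subgroupOf B
  have hnd : ¬ q ∣ Nat.card (B ⧸ A.subgroupOf B) := by
    intro hd
    have := hq.dvd_of_dvd_pow (hd.trans hi)
    exact hqr ((Nat.prime_dvd_prime_iff_eq hq hr).mp this).symm
  obtain ⟨y, hy⟩ := hNp.nonempty_fixed_point_of_prime_not_dvd_card (B ⧸ A.subgroupOf B) hnd
  obtain ⟨b, rfl⟩ := QuotientGroup.mk_surjective y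
  have hz : a⁻¹ * h * a * h⁻¹ ∈ B := B.mul_mem (hBS h1) (hBA (A.inv_mem hh))
  have hzQ : a⁻¹ * h * a * h⁻¹ ∈ Q := by
    have : a⁻¹ * h * a * h⁻¹ = a⁻¹ * (h * a * h⁻¹) := by group
    rw [this]
    exact Q.mul_mem (Q.inv_mem ha) (hQ.conj_mem a ha h)
  set z : B := ⟨a⁻¹ * h * a * h⁻¹, hz⟩ with hzd
  have hzN : b * z * b⁻¹ ∈ Q.subgroupOf B := hNn.conj_mem z hzQ b
  have h2 := hy ⟨_, hzN⟩
  have h3 : ((b * z * b⁻¹ * b : B) : B ⧸ A.subgroupOf B) = (b : B ⧸ A.subgroupOf B) := h2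
  rw [eq_comm, QuotientGroup.eq] at h3
  have h4 : b⁻¹ * (b * z * b⁻¹ * b) = z := by group
  rw [h4] at h3
  exact h3

theorem exists_compl {G : Type*} [Group G] [Finite G] {q s : ℕ} (hq : q.Prime) (hs : s.Prime)
    (hsq : s ≠ q) (Q : Sylow q G) (hQ : (Q : Subgroup G).Normal) (S : Sylow s G) :
    ∃ C : Subgroup G, (S : Subgroup G) ≤ C ∧ (Nat.card C).Coprime q ∧
      ∀ x : G, ∃ a ∈ (Q : Subgroup G), ∃ c ∈ C, x = a * c := by
  have : Fact q.Prime := ⟨hq⟩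
  have : Fact s.Prime := ⟨hs⟩
  obtain ⟨C0, hC0⟩ := Subgroup.exists_right_complement'_of_coprime Q.card_coprime_index
  have hcard : Nat.card C0 = (Q : Subgroup G).index := hC0.symm.index_eq_card.symm
  have hind : C0.index = Nat.card (Q : Subgroup G) := hC0.index_eq_card
  obtain ⟨k, hk⟩ := IsPGroup.iff_card.mp Q.isPGroup'
  have hcop : s.Coprime q := (Nat.coprime_primes hs hq).mpr hsq
  obtain ⟨R, hR⟩ := exists_sylow_le hs (T := C0) (by rw [hind, hk]; exact hcop.pow_right k)
  obtain ⟨g, hg⟩ := MulAction.exists_smul_eq G R S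
  refine ⟨C0.map (MulAut.conj g).toMonoidHom, ?_, ?_, ?_⟩
  · intro x hx
    rw [← hg, Sylow.coe_subgroup_smul, Subgroup.mem_pointwise_smul_iff_inv_smul_mem] at hx
    refine ⟨_, hR hx, ?_⟩
    simp [mul_assoc]
  · refine Nat.Coprime.coprime_dvd_left (C0.card_map_dvd _) ?_
    rw [hcard, Nat.coprime_comm, hq.coprime_iff_not_dvd]
    exact Q.not_dvd_index
  · intro x
    obtain ⟨⟨a, c⟩, e⟩ := hC0.surjective (g⁻¹ * x * g)
    have e : (a : G) * (c : G) = g⁻¹ * x * g := e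
    refine ⟨g * a * g⁻¹, hQ.conj_mem a a.2 g, g * c * g⁻¹, ⟨c, c.2, by simp⟩, ?_⟩
    calc x = g * (g⁻¹ * x * g) * g⁻¹ := by group
      _ = g * (a * c) * g⁻¹ := by rw [e]
      _ = _ := by group

theorem mul_pow_norm {G : Type*} [Group G] {K : Subgroup G} {k b : G} (hk : k ∈ K)
    (hb : ∀ x ∈ K, b * x * b⁻¹ ∈ K) (j : ℕ) : (k * b) ^ j * (b ^ j)⁻¹ ∈ K := by
  induction j with
  | zero => simp
  | succ j ih =>
    have : (k * b) ^ (j + 1) * (b ^ (j + 1))⁻¹ = k * (b * ((k * b) ^ j * (b ^ j)⁻¹) * b⁻¹) := by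
      rw [pow_succ', pow_succ' b]; group
    rw [this]
    exact K.mul_mem hk (hb _ ih)

/-- in the second case the Sylow subgroup normalizes subnormally permutable subgroups -/
theorem norm_case2 {G : Type*} [Group G] [Finite G] {q : ℕ} (hq : q.Prime) {Q : Subgroup G}
    (hQn : Q.Normal) (hQp : IsPGroup q Q) (hQi : Q.index.Coprime q)
    (hall : ∀ A : Subgroup G, A ≤ Q → A.Normal) {H : Subgroup G} (hH : SPermutable H)
    {K : Subgroup H} (hK : SPermutable K) {b k : G} (hb : b ∈ Q) (hk : k ∈ K.map H.subtype) :
    b⁻¹ * k * b ∈ K.map H.subtype := by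
  have hA : (K.map H.subtype ⊓ Q).Normal := hall _ inf_le_right
  suffices h : K.map H.subtype ≤ (K.map H.subtype).comap (MulAut.conj b⁻¹).toMonoidHom by
    simpa using h hk
  apply le_of_prime_power
  rintro r hr k hk ⟨n, hn⟩
  have goal : b⁻¹ * k * b ∈ K.map H.subtype := by
    by_cases hrq : r = q
    · subst hrq
      have hkQ := mem_of_pelt hQn hQi hn
      simpa using (hA.conj_mem k ⟨hk, hkQ⟩ b⁻¹).1
    · have hkH : k ∈ H := Subgroup.map_subtype_le _ hk
      have hz := comm_mem hq hr hrq hQn hQp hH hkH hn hb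
      have hzQ : b⁻¹ * k * b * k⁻¹ ∈ Q := by
        have : b⁻¹ * k * b * k⁻¹ = b⁻¹ * (k * b * k⁻¹) := by group
        rw [this]
        exact Q.mul_mem (Q.inv_mem hb) (hQn.conj_mem b hb k)
      set z := b⁻¹ * k * b * k⁻¹ with hzd
      have hkK : (⟨k, hkH⟩ : H) ∈ K := by
        obtain ⟨y, hy, e⟩ := hk
        have : y = ⟨k, hkH⟩ := Subtype.ext e
        rwa [← this]
      have h2 := comm_mem hq hr hrq (hQn.subgroupOf H) (hQp.comap_subtype) hK hkK (n := n)
        (by ext; simpa using hn) (a := ⟨z, hz⟩) hzQ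
      have h3 : z⁻¹ * k * z * k⁻¹ ∈ K.map H.subtype ⊓ Q := by
        refine ⟨⟨_, h2, rfl⟩, ?_⟩
        have : z⁻¹ * k * z * k⁻¹ = z⁻¹ * (k * z * k⁻¹) := by group
        rw [this]
        exact Q.mul_mem (Q.inv_mem hzQ) (hQn.conj_mem z hzQ k)
      set A := K.map H.subtype ⊓ Q with hAd
      obtain ⟨m, hm⟩ := pgroup_elt hQp hzQ
      have h4 : QuotientGroup.mk' A z = 1 := by
        refine cop_comm (x := QuotientGroup.mk' A k) (a := QuotientGroup.mk' A b) (m := r ^ n)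
          (n := q ^ m) ?_ ?_ ?_ ?_ (Nat.Coprime.pow n m ((Nat.coprime_primes hr hq).mpr hrq))
        · rw [← map_pow, hn, map_one]
        · rw [← map_mul, ← map_inv, ← map_mul, ← map_mul, hzd]
          congr 1
          group
        · rw [← map_mul, ← map_inv, ← map_mul]
          symm
          apply QuotientGroup.eq.mpr
          have : z⁻¹ * (k * z * k⁻¹) = z⁻¹ * k * z * k⁻¹ := by group
          rw [this]; exact h3
        · rw [← map_pow, hm, map_one]
      have h5 : z ∈ A := (QuotientGroup.eq_one_iff _).mp h4
      have : b⁻¹ * k * b = z * k := by rw [hzd]; group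
      rw [this]
      exact mul_mem h5.1 hk
  simpa using goal

theorem perm_of_sub {G : Type*} [Group G] {K S : Subgroup G}
    (h : ∀ k ∈ K, ∀ x ∈ S, k * x ∈ (S : Set G) * (K : Set G)) :
    (K : Set G) * (S : Set G) = (S : Set G) * (K : Set G) := by
  apply Set.Subset.antisymm
  · rintro _ ⟨k, hk, x, hx, rfl⟩
    exact h k hk x hx
  · rintro _ ⟨x, hx, k, hk, rfl⟩
    obtain ⟨y, hy, l, hl, e⟩ := h k⁻¹ (K.inv_mem hk) x⁻¹ (S.inv_mem hx)
    have e : y * l = k⁻¹ * x⁻¹ := e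
    refine ⟨l⁻¹, K.inv_mem hl, y⁻¹, S.inv_mem hy, ?_⟩
    change l⁻¹ * y⁻¹ = x * k
    rw [← mul_inv_rev, e]; group

theorem PST_of_X_aux (n : ℕ) : ∀ (G : Type u) [Group G] [Finite G], Group.IsSolvable G →
    Nat.card G = n → (∀ p : ℕ, p.Prime → XP p G) → IsPST G := by
  induction n using Nat.strong_induction_on with
  | _ n ih =>
  intro G _ _ hsol hcard hX
  rcases subsingleton_or_nontrivial G with hsub | hnt
  · intro H _ K _ s _ S
    have : (S : Subgroup G) = K.map H.subtype := Subsingleton.elim _ _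
    rw [this]
  obtain ⟨q, hq, hqd, hmax⟩ := exists_max_prime G
  have : Fact q.Prime := ⟨hq⟩
  intro H hH K hK s hs S
  by_cases hsq : s = q
  · subst hsq
    exact (perm_of_normal (tower hsol hX hs hmax S)).symm
  obtain ⟨Q⟩ : Nonempty (Sylow q G) := inferInstance
  have hQn := tower hsol hX hq hmax Q
  have hQp := Q.isPGroup'
  have hQi : (Q : Subgroup G).index.Coprime q := by
    rw [Nat.coprime_comm, hq.coprime_iff_not_dvd]; exact Q.not_dvd_index
  have hQb : (Q : Subgroup G) ≠ ⊥ := Q.ne_bot_of_dvd_card hqd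
  have hcq : Nat.card (G ⧸ (Q : Subgroup G)) < n := by
    rw [← hcard, Subgroup.card_eq_card_quotient_mul_card_subgroup (Q : Subgroup G)]
    have h1 : 1 < Nat.card (Q : Subgroup G) := by
      rw [Subgroup.one_lt_card_iff_ne_bot]; exact hQb
    have h2 : 0 < Nat.card (G ⧸ (Q : Subgroup G)) := Nat.card_pos
    nlinarith
  have hf := QuotientGroup.mk'_surjective (Q : Subgroup G)
  set f := QuotientGroup.mk' (Q : Subgroup G) with hfd
  have hPq := ih _ hcq (G ⧸ (Q : Subgroup G)) inferInstance rfl (fun p hp => (hX p hp).map hp hf)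
  have hKq := hPq (H.map f) (hH.map hf) (K.map (f.subgroupMap H)) (hK.map (f.subgroupMap_surjective H))
  have hKe : (K.map (f.subgroupMap H)).map (H.map f).subtype = (K.map H.subtype).map f := by
    rw [Subgroup.map_map, Subgroup.map_map]; rfl
  rw [hKe] at hKq
  have : Fact s.Prime := ⟨hs⟩
  have hKS := hKq s hs (S.mapSurjective hf)
  rw [Sylow.coe_mapSurjective] at hKS
  have hdec : ∀ k ∈ K.map H.subtype, ∀ x ∈ (S : Subgroup G), ∃ x' ∈ (S : Subgroup G),
      ∃ k' ∈ K.map H.subtype, ∃ b ∈ (Q : Subgroup G), k * x = x' * (k' * b) := by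
    intro k hk x hx
    have : f k * f x ∈ (((S : Subgroup G).map f : Subgroup (G ⧸ (Q : Subgroup G))) : Set (G ⧸ (Q : Subgroup G))) *
        (((K.map H.subtype).map f : Subgroup (G ⧸ (Q : Subgroup G))) : Set (G ⧸ (Q : Subgroup G))) := by
      rw [← hKS]
      exact ⟨f k, ⟨k, hk, rfl⟩, f x, ⟨x, hx, rfl⟩, rfl⟩
    obtain ⟨_, ⟨x', hx', rfl⟩, _, ⟨k', hk', rfl⟩, e⟩ := this
    have e : f x' * f k' = f k * f x := e
    rw [← map_mul, ← map_mul] at e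
    have e2 := QuotientGroup.eq.mp e
    exact ⟨x', hx', k', hk', _, e2, by group⟩
  clear_value f
  obtain ⟨C, hSC, hCq, hQC⟩ := exists_compl hq hs hsq Q hQn S
  have hCel : ∀ c ∈ C, c ^ (Nat.card C) = 1 := by
    intro c hc
    exact congrArg Subtype.val (pow_card_eq_one' (x := (⟨c, hc⟩ : C)))
  obtain ⟨hclaim, hnorm⟩ : (∀ c ∈ C, ∀ k ∈ K.map H.subtype, ∀ b ∈ (Q : Subgroup G), c = k * b →
      c ∈ K.map H.subtype) ∧ (∀ x ∈ (S : Subgroup G), ∀ a ∈ K.map H.subtype, a ∈ (Q : Subgroup G) →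
      x⁻¹ * a * x ∈ K.map H.subtype) := by
    obtain ⟨N, M, hN, hNM, hco, hk, hor⟩ := hX q hq
    rcases hor with rfl | ⟨hi, hA⟩
    · have hCN : ∀ c ∈ C, c ∈ N := by
        intro c hc
        obtain ⟨j, hj⟩ := hk c trivial
        exact mem_of_coprime_pow (hCq.symm.pow_left j) hj (hCel c hc)
      constructor
      · intro c hc k hk b hb e
        have h1 := comm_of_disjoint hN hQn hco hQp (hCN c hc) (Q.inv_mem hb)
        have h2 : Commute c b⁻¹ := mul_inv_eq_iff_eq_mul.mp h1
        obtain ⟨j, hj⟩ := pgroup_elt hQp hb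
        refine mem_of_coprime_pow (m := q ^ j) (hCq.symm.pow_left j) ?_ (hCel c hc)
        have h3 : k = c * b⁻¹ := by rw [e]; group
        have h4 : k ^ (q ^ j) = c ^ (q ^ j) := by
          rw [h3, h2.mul_pow, inv_pow, hj]; simp
        rw [← h4]
        exact pow_mem hk _
      · intro x hx a ha haQ
        have h1 := comm_of_disjoint hN hQn hco hQp (hCN _ (C.inv_mem (hSC hx))) haQ
        rw [inv_inv] at h1
        rw [h1]; exact ha
    · have hMn : M.Normal := hA M hNM le_rfl
      have hQM : (Q : Subgroup G) ≤ M := by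
        intro a ha
        obtain ⟨j, hj⟩ := pgroup_elt hQp ha
        exact mem_of_pelt hMn hi hj
      have hall : ∀ A : Subgroup G, A ≤ (Q : Subgroup G) → A.Normal := fun A hAQ =>
        normal_of_XP2 hN hco hNM hA hQn hQp hQM hAQ
      constructor
      · intro c hc k hk b hb e
        obtain ⟨j, hj⟩ := pgroup_elt hQp hb
        refine mem_of_coprime_pow (m := q ^ j) (hCq.symm.pow_left j) ?_ (hCel c hc)
        have h1 := mul_pow_norm hk (b := b) (fun x hx => by
          have := norm_case2 hq hQn hQp hQi hall hH hK (Q.inv_mem hb) hx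
          simpa using this) (q ^ j)
        rw [hj, ← e] at h1
        simpa using h1
      · intro x hx a ha haQ
        have := (hall (K.map H.subtype ⊓ (Q : Subgroup G)) inf_le_right).conj_mem a ⟨ha, haQ⟩ x⁻¹
        rw [inv_inv] at this
        exact this.1
  apply perm_of_sub
  intro k hk x hx
  obtain ⟨a, ha, c, hc, e⟩ := hQC k
  have hcK : c ∈ K.map H.subtype := by
    refine hclaim c hc k hk (k⁻¹ * a⁻¹ * k) ?_ ?_
    · simpa using hQn.conj_mem a⁻¹ (inv_mem ha) k⁻¹
    · rw [e]; group
  have haK : a ∈ K.map H.subtype := by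
    have : a = k * c⁻¹ := by rw [e]; group
    rw [this]; exact mul_mem hk (inv_mem hcK)
  obtain ⟨x', hx', k', hk', b, hb, e2⟩ := hdec c hcK x hx
  have hkb : k' * b ∈ K.map H.subtype := by
    refine hclaim _ ?_ k' hk' b hb rfl
    have : k' * b = x'⁻¹ * (c * x) := by rw [e2]; group
    rw [this]
    exact C.mul_mem (C.inv_mem (hSC hx')) (C.mul_mem hc (hSC hx))
  refine ⟨x', hx', (x'⁻¹ * a * x') * (k' * b), mul_mem (hnorm x' hx' a haK ha) hkb, ?_⟩
  change x' * ((x'⁻¹ * a * x') * (k' * b)) = k * x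
  calc x' * ((x'⁻¹ * a * x') * (k' * b)) = a * (x' * (k' * b)) := by group
    _ = a * (c * x) := by rw [e2]
    _ = k * x := by rw [e]; group

theorem PST_of_X {G : Type*} [Group G] [Finite G] (hs : Group.IsSolvable G)
    (hX : ∀ p : ℕ, p.Prime → XP p G) : IsPST G := PST_of_X_aux _ G hs rfl hX

/-- **Corollary 1.2.** A finite group `G` is a soluble `PST`-group if and only if
every maximal subgroup of every Sylow subgroup of `G` has a supplement in `G` that
is a soluble `PST`-group. -/
theorem soluble_PST_iff_supplements (G : Type*) [Group G] [Finite G] :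
    (IsSolvable G ∧ IsPST G) ↔
      ∀ p : ℕ, p.Prime → p ∣ Nat.card G →
        ∀ (P : Sylow p G) (V : Subgroup G), V < ↑P →
          (∀ W : Subgroup G, V < W → W ≤ ↑P → W = ↑P) →
          ∃ T : Subgroup G, (V : Set G) * (T : Set G) = Set.univ ∧
            IsSolvable ↥T ∧ IsPST ↥T := by
  constructor
  · rintro ⟨hs, hG⟩ p _ _ P V _ _
    have hs' : Group.IsSolvable G := hs
    have hsT : Group.IsSolvable (⊤ : Subgroup G) := inferInstance
    refine ⟨⊤, ?_, hsT, ?_⟩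
    · rw [Set.eq_univ_iff_forall]
      intro x
      exact ⟨1, V.one_mem, x, trivial, by simp⟩
    · exact PST_of_X hsT fun r hr =>
        (XP_of_PST hs' hG hr).map hr (f := (Subgroup.topEquiv (G := G)).symm.toMonoidHom)
          Subgroup.topEquiv.symm.surjective
  · intro h
    have hG := HYP_of_supp h
    have hs := solvable_of_HYP hG
    exact ⟨hs, PST_of_X hs fun p hp => XP_of_HYP hs hG hp⟩
end

section
/- Let G be a finite group. Suppose that for every prime p dividing |G|, every Sylow p-subgroup P of G, and every maximal subgroup V of P, there exists a subgroup T of G with VT = G such that T is soluble. Then G is soluble. -/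
open Polynomial

lemma roots_unity_avg (n : ℕ) (hn : 0 < n) (s : Multiset ℂ) (hs : ∀ x ∈ s, x ^ n = 1)
    (hIntg : IsIntegral ℤ (s.sum / (s.card : ℂ))) (h0 : s.sum ≠ 0) :
    ∀ x ∈ s, x = s.sum / (s.card : ℂ) := by
  have hd : (0:ℝ) < s.card := by
    rcases Nat.eq_zero_or_pos s.card with h | h
    · rw [Multiset.card_eq_zero] at h; simp [h] at h0
    · exact_mod_cast h
  have hdC : (s.card : ℂ) ≠ 0 := by
    intro h; have : s.card = 0 := by exact_mod_cast h
    rw [this] at hd; simp at hd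
  let S : Set ℂ := {x | x ^ n = 1}
  have hfin : S.Finite := by
    have : S ⊆ ((X ^ n - 1 : ℂ[X]).roots.toFinset : Set ℂ) := by
      intro x hx
      have hx : x ^ n = 1 := hx
      have : (X ^ n - 1 : ℂ[X]) ≠ 0 := X_pow_sub_C_ne_zero hn 1
      simp [this, hx, IsRoot]
    exact (Finset.finite_toSet _).subset this
  let K := IntermediateField.adjoin ℚ S
  have : Finite S := hfin
  have : FiniteDimensional ℚ K := by
    apply IntermediateField.finiteDimensional_adjoin
    intro x hx
    refine ⟨X ^ n - 1, monic_X_pow_sub_C 1 hn.ne', ?_⟩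
    have hx : x ^ n = 1 := hx
    simp [hx]
  have : NumberField K := NumberField.mk
  have hsK : ∀ x ∈ s, x ∈ K := fun x hx => IntermediateField.subset_adjoin _ _ (hs x hx)
  obtain ⟨t, ht⟩ : ∃ t : Multiset K, t.map (Subtype.val) = s := by
    refine ⟨s.attach.map (fun x => ⟨x.1, hsK x.1 x.2⟩), ?_⟩
    simp
  have hcard : t.card = s.card := by rw [← ht]; simp
  let a : K := t.sum / (t.card : K)
  have ha : (a : ℂ) = s.sum / (s.card : ℂ) := by
    have : ((t.sum : K) : ℂ) = s.sum := by
      rw [← ht]; exact map_multiset_sum (algebraMap K ℂ) t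
    simp [a, this, hcard]
  have hbd : ∀ φ : K →+* ℂ, ‖φ a‖ ≤ 1 := by
    intro φ
    have h1 : ‖φ t.sum‖ ≤ t.card := by
      rw [map_multiset_sum]
      refine (norm_multiset_sum_le _).trans ?_
      rw [Multiset.map_map]
      refine (Multiset.sum_le_card_nsmul _ 1 ?_).trans ?_
      · intro y hy
        obtain ⟨x, hx, rfl⟩ := Multiset.mem_map.1 hy
        have : (x:ℂ) ^ n = 1 := hs _ (by rw [← ht]; exact Multiset.mem_map_of_mem _ hx)
        have : x ^ n = 1 := by exact_mod_cast this
        have : (φ x) ^ n = 1 := by rw [← map_pow, this, map_one]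
        exact (Complex.norm_eq_one_of_pow_eq_one this hn.ne').le
      · simp
    rw [map_div₀, norm_div, map_natCast, Complex.norm_natCast, hcard]
    rw [hcard] at h1
    exact (div_le_one hd).2 h1
  have ha0 : a ≠ 0 := by
    intro h
    rw [h] at ha
    exact div_ne_zero h0 hdC (by simpa using ha.symm)
  have hai : IsIntegral ℤ a := by
    rw [← ha] at hIntg
    exact (isIntegral_algebraMap_iff (algebraMap K ℂ).injective).1 hIntg
  obtain ⟨m, hm, ham⟩ := NumberField.Embeddings.pow_eq_one_of_norm_le_one K ℂ ha0 hai hbd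
  rw [← ha]
  have ham' : (a:ℂ)^m = 1 := by exact_mod_cast ham
  have hna : ‖(a:ℂ)‖ = 1 := Complex.norm_eq_one_of_pow_eq_one ham' hm.ne'
  generalize (a : ℂ) = b at *
  have hbb : (starRingEnd ℂ) b * b = 1 := by
    rw [mul_comm, Complex.mul_conj, Complex.normSq_eq_norm_sq, hna]; simp
  have key : ∀ x ∈ s, ((starRingEnd ℂ b) * x).re ≤ 1 := by
    intro x hx
    refine (Complex.re_le_norm _).trans ?_
    rw [norm_mul, Complex.norm_conj, hna, Complex.norm_eq_one_of_pow_eq_one (hs x hx) hn.ne']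
    simp
  have hsum : (s.map (fun x => ((starRingEnd ℂ b) * x).re)).sum = s.card := by
    have : ((starRingEnd ℂ b) * s.sum).re = s.card := by
      rw [show s.sum = b * s.card by rw [ha]; field_simp, ← mul_assoc, hbb]; simp
    rw [← this]
    have h := map_multiset_sum (Complex.reAddGroupHom.comp (AddMonoidHom.mulLeft (starRingEnd ℂ b))) s
    exact h.symm
  intro x hx
  have hre : ((starRingEnd ℂ b) * x).re = 1 := by
    by_contra hne
    have hlt : ((starRingEnd ℂ b) * x).re < 1 := lt_of_le_of_ne (key x hx) hne
    have := Multiset.sum_lt_sum (s := s) (f := fun x => ((starRingEnd ℂ b) * x).re) (g := fun _ => (1:ℝ)) key ⟨x, hx, hlt⟩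
    rw [hsum] at this
    simp at this
  have hnx : ‖(starRingEnd ℂ b) * x‖ = 1 := by
    rw [norm_mul, Complex.norm_conj, hna, Complex.norm_eq_one_of_pow_eq_one (hs x hx) hn.ne']
    simp
  have h1 : (starRingEnd ℂ b) * x = 1 := by
    have h2 := Complex.sq_norm ((starRingEnd ℂ b) * x)
    rw [hnx, Complex.normSq_apply, hre] at h2
    apply Complex.ext
    · simpa using hre
    · have : ((starRingEnd ℂ b) * x).im * ((starRingEnd ℂ b) * x).im = 0 := by linarith
      simpa using this
  calc x = (b * starRingEnd ℂ b) * x := by rw [mul_comm b, hbb, one_mul]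
    _ = b := by rw [mul_assoc, h1, mul_one]

lemma matrix_root_charpoly {ι : Type*} [Fintype ι] [DecidableEq ι] (n : ℕ) (U : Matrix ι ι ℂ)
    (hU : U ^ n = 1) : ∀ x ∈ U.charpoly.roots, x ^ n = 1 := by
  intro x hx
  have hx' : x ∈ spectrum ℂ U := by
    rw [Matrix.mem_spectrum_iff_isRoot_charpoly]
    exact Polynomial.isRoot_of_mem_roots hx
  have hp := spectrum.pow_mem_pow U n hx'
  rw [hU] at hp
  have : Nontrivial (Matrix ι ι ℂ) := by
    by_contra h
    rw [not_nontrivial_iff_subsingleton] at h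
    simp [spectrum.of_subsingleton] at hx'
  simpa [spectrum.one_eq] using hp

lemma matrix_scalar {ι : Type*} [Fintype ι] [DecidableEq ι] [Nonempty ι] (n : ℕ) (hn : 0 < n)
    (U : Matrix ι ι ℂ) (hU : U ^ n = 1)
    (hIntg : IsIntegral ℤ (U.trace / (Fintype.card ι : ℂ))) (h0 : U.trace ≠ 0) :
    ∃ c : ℂ, U = Matrix.scalar ι c := by
  have hr := matrix_root_charpoly n U hU
  have htr := Matrix.trace_eq_sum_roots_charpoly U
  have hc : U.charpoly.roots.card = Fintype.card ι := by
    rw [← (IsAlgClosed.splits U.charpoly).natDegree_eq_card_roots, Matrix.charpoly_natDegree_eq_dim]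
  have hall := roots_unity_avg n hn U.charpoly.roots hr (by rw [hc, ← htr]; exact hIntg) (by rwa [← htr])
  set c := U.charpoly.roots.sum / (U.charpoly.roots.card : ℂ)
  refine ⟨c, ?_⟩
  have hdvd : minpoly ℂ U ∣ X ^ n - 1 := minpoly.dvd _ _ (by simp [hU])
  have hsep : (minpoly ℂ U).Separable := by
    refine Polynomial.Separable.of_dvd ?_ hdvd
    exact (Polynomial.separable_X_pow_sub_C (1:ℂ) (by exact_mod_cast hn.ne') one_ne_zero)
  have hnd := Polynomial.nodup_roots hsep
  have hroots : ∀ x ∈ (minpoly ℂ U).roots, x = c := by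
    intro x hx
    apply hall
    rw [Polynomial.mem_roots (Matrix.charpoly_monic U).ne_zero]
    exact (Polynomial.isRoot_of_mem_roots hx).dvd (Matrix.minpoly_dvd_charpoly U)
  have hle : (minpoly ℂ U).roots ≤ {c} := by
    rw [Multiset.le_iff_subset hnd]
    intro x hx
    simp [hroots x hx]
  have hdv : minpoly ℂ U ∣ X - C c := by
    rw [(IsAlgClosed.splits (minpoly ℂ U)).eq_prod_roots_of_monic (minpoly.monic (Matrix.isIntegral U))]
    refine (Multiset.prod_dvd_prod_of_le (Multiset.map_le_map hle)).trans ?_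
    simp
  have := (minpoly.dvd_iff).1 hdv
  simp [sub_eq_zero] at this
  rw [this]; rfl

lemma trace_int {ι : Type*} [Fintype ι] [DecidableEq ι] (n : ℕ) (hn : 0 < n)
    (U : Matrix ι ι ℂ) (hU : U ^ n = 1) : IsIntegral ℤ U.trace := by
  rw [Matrix.trace_eq_sum_roots_charpoly U]
  apply IsIntegral.multiset_sum
  intro x hx
  refine ⟨X ^ n - 1, monic_X_pow_sub_C 1 hn.ne', ?_⟩
  simp [matrix_root_charpoly n U hU x hx]

section wedderburn
variable {G : Type*} [Group G] [Finite G] {n : ℕ} {d : Fin n → ℕ}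
  (e : MonoidAlgebra ℂ G ≃ₐ[ℂ] Π i, Matrix (Fin (d i)) (Fin (d i)) ℂ)

/-- The matrix representations of the Wedderburn components. -/
noncomputable def wrep (i : Fin n) : G →* Matrix (Fin (d i)) (Fin (d i)) ℂ where
  toFun h := e (MonoidAlgebra.of ℂ G h) i
  map_one' := by rw [map_one, map_one, Pi.one_apply]
  map_mul' a b := by rw [map_mul, map_mul, Pi.mul_apply]

lemma wrep_apply (i : Fin n) (h : G) : wrep e i h = e (MonoidAlgebra.of ℂ G h) i := rfl

lemma wrep_commute (i : Fin n) (Y : Matrix (Fin (d i)) (Fin (d i)) ℂ)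
    (hY : ∀ h, Y * wrep e i h = wrep e i h * Y) : ∃ c, Y = Matrix.scalar _ c := by
  have h1 : ∀ a : MonoidAlgebra ℂ G, Y * e a i = e a i * Y := by
    intro a
    induction a using MonoidAlgebra.induction_on with
    | of g => exact hY g
    | add a b ha hb => simp [mul_add, add_mul, ha, hb]
    | smul r a ha => simp [ha]
  have h2 : Y ∈ Set.center (Matrix (Fin (d i)) (Fin (d i)) ℂ) := by
    rw [Semigroup.mem_center_iff]
    intro X
    have := h1 (e.symm (Pi.single i X))
    simpa using this.symm
  rw [Matrix.center_eq_range] at h2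
  obtain ⟨c, hc⟩ := h2
  exact ⟨c, hc.symm⟩

lemma wrep_triv (i : Fin n) (hi : ∀ h, wrep e i h = 1) :
    ∀ a, e a i = (MonoidAlgebra.lift ℂ ℂ G 1 a) • (1 : Matrix (Fin (d i)) (Fin (d i)) ℂ) := by
  intro a
  induction a using MonoidAlgebra.induction_on with
  | of g => rw [← wrep_apply, hi]; simp
  | add a b ha hb => simp [add_smul, ha, hb]
  | smul r a ha => simp [ha, mul_smul]

lemma wrep_triv_unique (hd : ∀ i, NeZero (d i)) (i j : Fin n) (hi : ∀ h, wrep e i h = 1)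
    (hj : ∀ h, wrep e j h = 1) : i = j := by
  by_contra hne
  have hd1 := hd i
  have hd2 := hd j
  have hf := wrep_triv e i hi
  have hf' := wrep_triv e j hj
  generalize MonoidAlgebra.lift ℂ ℂ G 1 = f at hf hf'
  have h1 := hf (e.symm (Pi.single i 1))
  have h2 := hf' (e.symm (Pi.single i 1))
  simp only [AlgEquiv.apply_symm_apply, Pi.single_eq_same] at h1 h2
  rw [Pi.single_eq_of_ne (Ne.symm hne)] at h2
  have h3 := congrFun (congrFun h2 0) 0
  have h4 := congrFun (congrFun h1 0) 0
  simp at h3 h4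
  rw [← h3] at h4
  simp at h4

lemma wrep_triv_dim (hd : ∀ i, NeZero (d i)) (i : Fin n) (hi : ∀ h, wrep e i h = 1) :
    d i = 1 := by
  have hf := wrep_triv e i hi
  generalize MonoidAlgebra.lift ℂ ℂ G 1 = f at hf
  have hd1 := hd i
  by_contra hne
  have h2 : 1 < d i := by have := hd1.out; omega
  let z : Fin (d i) := ⟨0, by omega⟩
  let o : Fin (d i) := ⟨1, h2⟩
  have h1 := hf (e.symm (Pi.single i (Matrix.single z z 1)))
  simp only [AlgEquiv.apply_symm_apply, Pi.single_eq_same] at h1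
  have h3 := congrFun (congrFun h1 z) z
  have h4 := congrFun (congrFun h1 o) o
  have hzo : z ≠ o := by simp [z, o]
  simp [hzo] at h3 h4
  rw [← h4] at h3
  simp at h3

lemma wrep_triv_exists : ∃ i, ∀ h, wrep e i h = 1 := by
  classical
  have := Fintype.ofFinite G
  let s : MonoidAlgebra ℂ G := ∑ h : G, MonoidAlgebra.of ℂ G h
  have hs : s ≠ 0 := by
    intro h
    have h1 : (MonoidAlgebra.lift ℂ ℂ G 1) s = 0 := by rw [h, map_zero]
    simp [s] at h1
  have hes : e s ≠ 0 := by simpa using hs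
  obtain ⟨i, hi⟩ := Function.ne_iff.1 hes
  have hl : ∀ h, MonoidAlgebra.of ℂ G h * s = s := by
    intro h
    simp only [s, Finset.mul_sum, ← map_mul]
    exact Fintype.sum_equiv (Equiv.mulLeft h) _ _ (fun _ => rfl)
  have hr : ∀ h, s * MonoidAlgebra.of ℂ G h = s := by
    intro h
    simp only [s, Finset.sum_mul, ← map_mul]
    exact Fintype.sum_equiv (Equiv.mulRight h) _ _ (fun _ => rfl)
  have hl' : ∀ h, wrep e i h * e s i = e s i := by
    intro h
    have := congrArg (fun a => e a i) (hl h)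
    simp only [map_mul, Pi.mul_apply] at this
    exact this
  have hr' : ∀ h, e s i * wrep e i h = e s i := by
    intro h
    have := congrArg (fun a => e a i) (hr h)
    simp only [map_mul, Pi.mul_apply] at this
    exact this
  obtain ⟨c, hc⟩ := wrep_commute e i (e s i) (fun h => by rw [hl', hr'])
  have hc0 : c ≠ 0 := by
    rintro rfl
    apply hi
    simpa using hc
  refine ⟨i, fun h => ?_⟩
  have := hl' h
  rw [hc, show Matrix.scalar (Fin (d i)) c = algebraMap ℂ _ c from rfl, Algebra.algebraMap_eq_smul_one, mul_smul_comm, mul_one] at this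
  exact smul_right_injective _ hc0 this

lemma wrep_trace (g : G) (hg : g ≠ 1) : ∑ i, (d i : ℂ) * (wrep e i g).trace = 0 := by
  classical
  have := Fintype.ofFinite G
  have h1 : LinearMap.trace ℂ (MonoidAlgebra ℂ G)
      (LinearMap.mulLeft ℂ (MonoidAlgebra.of ℂ G g)) = 0 := by
    rw [LinearMap.trace_eq_matrix_trace ℂ (MonoidAlgebra.basis G ℂ), Matrix.trace]
    apply Finset.sum_eq_zero
    intro x _
    rw [Matrix.diag_apply, LinearMap.toMatrix_apply]
    simp only [MonoidAlgebra.basis_apply, LinearMap.mulLeft_apply, MonoidAlgebra.of_apply,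
      MonoidAlgebra.single_mul_single, mul_one]
    rw [← MonoidAlgebra.basis_apply, Module.Basis.repr_self, Finsupp.single_apply, if_neg]
    simpa using hg
  have h2 : LinearMap.trace ℂ (Π i, Matrix (Fin (d i)) (Fin (d i)) ℂ)
      (LinearMap.mulLeft ℂ (e (MonoidAlgebra.of ℂ G g))) = 0 := by
    rw [← h1, ← LinearMap.trace_conj' (LinearMap.mulLeft ℂ (MonoidAlgebra.of ℂ G g)) e.toLinearEquiv]
    congr 1
    refine LinearMap.ext fun x => ?_
    simp [LinearEquiv.conj_apply]
  rw [← h2, LinearMap.trace_eq_matrix_trace ℂ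
    (Pi.basis (fun i => Matrix.stdBasis ℂ (Fin (d i)) (Fin (d i)))), Matrix.trace,
    Fintype.sum_sigma]
  apply Finset.sum_congr rfl
  intro i _
  rw [Fintype.sum_prod_type]
  simp only [Matrix.diag_apply, LinearMap.toMatrix_apply]
  have : ∀ x y : Fin (d i), (((Pi.basis fun i => Matrix.stdBasis ℂ (Fin (d i)) (Fin (d i))).repr
      ((LinearMap.mulLeft ℂ (e (MonoidAlgebra.of ℂ G g)))
      ((Pi.basis fun i => Matrix.stdBasis ℂ (Fin (d i)) (Fin (d i))) ⟨i, (x, y)⟩))) ⟨i, (x, y)⟩)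
      = wrep e i g x x := by
    intro x y
    rw [Pi.basis_repr, Pi.basis_apply]
    simp only [LinearMap.mulLeft_apply, Pi.mul_apply, Pi.single_eq_same, wrep_apply,
      Matrix.stdBasis_eq_single]
    have hrepr : ∀ M : Matrix (Fin (d i)) (Fin (d i)) ℂ,
        (Matrix.stdBasis ℂ (Fin (d i)) (Fin (d i))).repr M (x, y) = M x y := by
      intro M
      simp [Matrix.stdBasis]
    rw [hrepr]
    simp
  simp only [this]
  simp [Matrix.trace, Finset.mul_sum]


lemma wrep_class (g : G) (i : Fin n) : IsIntegral ℤ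
    ((Nat.card {x | IsConj g x} : ℂ) * (wrep e i g).trace / (d i : ℂ)) := by
  classical
  have := Fintype.ofFinite G
  by_cases hdi : d i = 0
  · simp [hdi, isIntegral_zero]
  let s : Finset G := Finset.univ.filter (fun x => IsConj g x)
  let K : MonoidAlgebra ℤ G := ∑ x ∈ s, MonoidAlgebra.of ℤ G x
  have : Module.Finite ℤ (MonoidAlgebra ℤ G) := Module.Finite.of_basis (MonoidAlgebra.basis G ℤ)
  have hK : IsIntegral ℤ K := Algebra.IsIntegral.isIntegral K
  have h1 := hK.map (MonoidAlgebra.lift ℤ (Matrix (Fin (d i)) (Fin (d i)) ℂ) G (wrep e i))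
  have h2 : MonoidAlgebra.lift ℤ (Matrix (Fin (d i)) (Fin (d i)) ℂ) G (wrep e i) K
      = ∑ x ∈ s, wrep e i x := by
    simp [K]
  rw [h2] at h1
  obtain ⟨c, hc⟩ := wrep_commute e i (∑ x ∈ s, wrep e i x) (by
    intro h
    rw [Finset.sum_mul, Finset.mul_sum]
    refine Finset.sum_bij' (fun x _ => h⁻¹ * x * h) (fun x _ => h * x * h⁻¹) ?_ ?_ ?_ ?_ ?_
    · intro x hx
      simp only [s, Finset.mem_filter, Finset.mem_univ, true_and] at hx ⊢
      exact hx.trans (isConj_iff.2 ⟨h⁻¹, by simp⟩)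
    · intro x hx
      simp only [s, Finset.mem_filter, Finset.mem_univ, true_and] at hx ⊢
      exact hx.trans (isConj_iff.2 ⟨h, by simp⟩)
    · intro x _; group
    · intro x _; group
    · intro x _
      rw [← map_mul, ← map_mul]
      congr 1
      group)
  have htr : ∀ x ∈ s, (wrep e i x).trace = (wrep e i g).trace := by
    intro x hx
    simp only [s, Finset.mem_filter, Finset.mem_univ, true_and] at hx
    obtain ⟨y, rfl⟩ := isConj_iff.1 hx
    rw [map_mul, Matrix.trace_mul_comm, ← map_mul]
    congr 2
    group
  have h3 := congrArg Matrix.trace hc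
  rw [Matrix.trace_sum, Finset.sum_congr rfl htr] at h3
  have hcard : Nat.card {x | IsConj g x} = s.card := by
    rw [Nat.card_eq_fintype_card, Fintype.card_subtype]
    rfl
  have h4 : (Nat.card {x | IsConj g x} : ℂ) * (wrep e i g).trace / (d i : ℂ) = c := by
    have : (d i : ℂ) ≠ 0 := by exact_mod_cast hdi
    rw [hcard, div_eq_iff this]
    simpa [Matrix.trace, mul_comm] using h3
  rw [h4]
  rw [hc] at h1
  have : Nonempty (Fin (d i)) := ⟨⟨0, by omega⟩⟩
  exact (isIntegral_algebraMap_iff (R := ℤ) (A := ℂ) (B := Matrix (Fin (d i)) (Fin (d i)) ℂ)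
    (algebraMap ℂ (Matrix (Fin (d i)) (Fin (d i)) ℂ)).injective).1 h1

end wedderburn

lemma burnside_core {G : Type*} [Group G] [Finite G] (g : G) (hg : g ≠ 1) (q m : ℕ)
    (hq : q.Prime) (hcl : Nat.card {x | IsConj g x} = q ^ m) :
    ∃ (k : ℕ) (ρ : G →* Matrix (Fin k) (Fin k) ℂ) (c : ℂ), (∃ h, ρ h ≠ 1) ∧
      ρ g = Matrix.scalar (Fin k) c := by
  classical
  have := Fintype.ofFinite G
  have : NeZero (Nat.card G : ℂ) := ⟨by exact_mod_cast Nat.card_pos.ne'⟩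
  have : Module.Finite ℂ (MonoidAlgebra ℂ G) := Module.Finite.of_basis (MonoidAlgebra.basis G ℂ)
  obtain ⟨n, d, hd, ⟨e⟩⟩ :=
    IsSemisimpleRing.exists_algEquiv_pi_matrix_of_isAlgClosed ℂ (MonoidAlgebra ℂ G)
  by_contra hcon
  push Not at hcon
  obtain ⟨i0, hi0⟩ := wrep_triv_exists e
  have hN : 0 < Nat.card G := Nat.card_pos
  have hpow : ∀ i, (wrep e i g) ^ (Nat.card G) = 1 := fun i => by
    rw [← map_pow, pow_card_eq_one', map_one]
  have hterm : ∀ i, i ≠ i0 → ∃ y : ℂ, IsIntegral ℤ y ∧ (d i : ℂ) * (wrep e i g).trace = q * y := by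
    intro i hi
    have hdi := hd i
    have hIntg := trace_int _ hN _ (hpow i)
    by_cases hqd : q ∣ d i
    · obtain ⟨r, hr⟩ := hqd
      refine ⟨algebraMap ℤ ℂ r * (wrep e i g).trace, (isIntegral_algebraMap (R := ℤ) (x := (r : ℤ))).mul hIntg, ?_⟩
      have : (d i : ℂ) = q * r := by exact_mod_cast hr
      rw [this]; simp; ring
    · refine ⟨0, isIntegral_zero, ?_⟩
      by_contra hne
      have ht : (wrep e i g).trace ≠ 0 := by
        intro h; apply hne; rw [h]; simp
      have hnt : ∃ h, wrep e i h ≠ 1 := by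
        by_contra hall
        push Not at hall
        exact hi (wrep_triv_unique e hd i i0 hall hi0)
      have hcop : IsCoprime ((q ^ m : ℕ) : ℤ) (d i : ℤ) := by
        rw [Nat.isCoprime_iff_coprime]
        exact ((Nat.Prime.coprime_iff_not_dvd hq).2 hqd).pow_left m
      obtain ⟨a, b, hab⟩ := hcop
      have hcl' := wrep_class e g i
      rw [hcl] at hcl'
      have hd0 : (d i : ℂ) ≠ 0 := by exact_mod_cast hdi.out
      have hI : IsIntegral ℤ ((wrep e i g).trace / (Fintype.card (Fin (d i)) : ℂ)) := by
        have habC : (a : ℂ) * ((q ^ m : ℕ) : ℂ) + b * (d i : ℂ) = 1 := by exact_mod_cast hab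
        have : (wrep e i g).trace / (Fintype.card (Fin (d i)) : ℂ) =
            (a : ℂ) * (((q ^ m : ℕ) : ℂ) * (wrep e i g).trace / (d i : ℂ))
              + (b : ℂ) * (wrep e i g).trace := by
          rw [Fintype.card_fin]
          field_simp
          linear_combination -habC
        rw [this]
        exact ((isIntegral_algebraMap (R := ℤ) (A := ℂ) (x := a)).mul hcl').add
          ((isIntegral_algebraMap (R := ℤ) (A := ℂ) (x := b)).mul hIntg)
      obtain ⟨c, hc⟩ := matrix_scalar _ hN _ (hpow i) hI ht
      exact hcon _ (wrep e i) c hnt hc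
  choose! y hy1 hy2 using hterm
  have htr := wrep_trace e g hg
  rw [← Finset.add_sum_erase _ _ (Finset.mem_univ i0), hi0 g,
    Finset.sum_congr rfl (fun i hi => hy2 i (Finset.ne_of_mem_erase hi)), ← Finset.mul_sum,
    Matrix.trace_one, Fintype.card_fin, wrep_triv_dim e hd i0 hi0] at htr
  have hI : IsIntegral ℤ (∑ i ∈ Finset.univ.erase i0, y i) :=
    IsIntegral.sum _ (fun i hi => hy1 i (Finset.ne_of_mem_erase hi))
  set z := ∑ i ∈ Finset.univ.erase i0, y i
  have hq0 : (q : ℂ) ≠ 0 := by exact_mod_cast hq.ne_zero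
  have hz : z = algebraMap ℚ ℂ (-1 / q) := by
    simp at htr
    simp
    field_simp
    linear_combination htr
  rw [hz] at hI
  have hI' : IsIntegral ℤ (-1 / q : ℚ) := (isIntegral_algebraMap_iff (algebraMap ℚ ℂ).injective).1 hI
  obtain ⟨t, ht⟩ := IsIntegrallyClosed.isIntegral_iff.1 hI'
  have hq0' : (q : ℚ) ≠ 0 := by exact_mod_cast hq.ne_zero
  have h5 : (t : ℚ) * q = -1 := by
    have : (t : ℚ) = -1 / q := by simpa using ht
    rw [this]; field_simp
  have h6 : t * (q:ℤ) = -1 := by exact_mod_cast h5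
  have h7 : (q : ℤ) ∣ 1 := ⟨-t, by linear_combination h6⟩
  have h8 : q ∣ 1 := by exact_mod_cast h7
  exact hq.one_lt.ne' (Nat.dvd_one.1 h8)

section grouptheory
universe u

lemma class_card {G : Type*} [Group G] [Finite G] (p : ℕ) [Fact p.Prime] (P : Sylow p G) (z : G)
    (hz : ∀ x ∈ (P : Subgroup G), x * z = z * x) :
    Nat.card {x | IsConj z x} ∣ (P : Subgroup G).index := by
  have h1 : {x | IsConj z x} = MulAction.orbit (ConjAct G) z := by
    ext x
    rw [ConjAct.mem_orbit_conjAct]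
    exact isConj_comm
  rw [h1, Nat.card_coe_set_eq, ← MulAction.index_stabilizer]
  rw [← Subgroup.index_map_equiv (P : Subgroup G) (ConjAct.toConjAct : G ≃* ConjAct G)]
  apply Subgroup.index_dvd_of_le
  rintro _ ⟨x, hx, rfl⟩
  rw [MulAction.mem_stabilizer_iff]
  have := hz x hx
  simp [ConjAct.smul_def, this]

lemma burnside_simple {G : Type u} [Group G] [Finite G] [IsSimpleGroup G] (p q : ℕ)
    (hp : p.Prime) (hq : q.Prime) (hpG : p ∣ Nat.card G)
    (h : ∀ r : ℕ, r.Prime → r ∣ Nat.card G → r = p ∨ r = q) : Group.IsSolvable G := by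
  have : Fact p.Prime := ⟨hp⟩
  rcases (inferInstance : (Subgroup.center G).Normal).eq_bot_or_eq_top with hc | hc
  swap
  · apply Group.isSolvable_of_comm
    intro a b
    have : b ∈ Subgroup.center G := by rw [hc]; trivial
    exact Subgroup.mem_center_iff.1 this a
  exfalso
  obtain ⟨P⟩ : Nonempty (Sylow p G) := inferInstance
  have hPne : Nontrivial P := by
    rw [← Finite.one_lt_card_iff_nontrivial]
    have : p ∣ Nat.card P := P.dvd_card_of_dvd_card hpG
    exact hp.one_lt.trans_le (Nat.le_of_dvd Nat.card_pos this)
  have := P.isPGroup'.center_nontrivial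
  obtain ⟨⟨z, hz⟩, hz1⟩ := exists_ne (1 : Subgroup.center P)
  have hz1' : (z : G) ≠ 1 := by
    intro h
    apply hz1
    ext
    exact h
  have hcard := class_card p P z (fun x hx => by
    have := Subgroup.mem_center_iff.1 hz ⟨x, hx⟩
    exact congrArg Subtype.val this)
  have hdiv : ∀ r : ℕ, r.Prime → r ∣ Nat.card {x | IsConj (z : G) x} → r = q := by
    intro r hr hrd
    have h1 := hrd.trans hcard
    rcases h r hr (h1.trans (Subgroup.index_dvd_card _)) with rfl | h2
    · exact absurd h1 P.not_dvd_index
    · exact h2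
  have hne : Nat.card {x | IsConj (z : G) x} ≠ 0 := by
    have : Nonempty {x | IsConj (z : G) x} := ⟨⟨z, IsConj.refl _⟩⟩
    exact Nat.card_pos.ne'
  have hpow := Nat.eq_prime_pow_of_unique_prime_dvd hne (fun {r} => hdiv r)
  obtain ⟨k, ρ, c, ⟨x, hx⟩, hc'⟩ := burnside_core (z : G) hz1' q _ hq hpow
  rcases (inferInstance : ρ.ker.Normal).eq_bot_or_eq_top with hk | hk
  swap
  · apply hx
    rw [← MonoidHom.mem_ker, hk]; trivial
  have hinj := (MonoidHom.ker_eq_bot_iff ρ).1 hk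
  have : (z : G) ∈ Subgroup.center G := by
    rw [Subgroup.mem_center_iff]
    intro y
    apply hinj
    rw [map_mul, map_mul, hc']
    exact (Matrix.scalar_commute c (fun r => mul_comm _ _) (ρ y)).symm
  rw [hc] at this
  exact hz1' (Subgroup.mem_bot.1 this)

lemma burnside_paqb (p q : ℕ) (hp : p.Prime) (hq : q.Prime) (n : ℕ) :
    ∀ (G : Type u) [Group G] [Finite G], Nat.card G = n →
    (∀ r : ℕ, r.Prime → r ∣ Nat.card G → r = p ∨ r = q) → Group.IsSolvable G := by
  induction n using Nat.strong_induction_on with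
  | _ n ih =>
    intro G _ _ hn h
    rcases subsingleton_or_nontrivial G with hs | hnt
    · infer_instance
    by_cases hsimp : ∃ N : Subgroup G, N.Normal ∧ N ≠ ⊥ ∧ N ≠ ⊤
    · obtain ⟨N, hN, hb, ht⟩ := hsimp
      have hmul := N.card_mul_index
      have hNpos : 0 < Nat.card N := Nat.card_pos
      have hipos : 0 < N.index := Nat.pos_of_ne_zero N.index_ne_zero_of_finite
      have h1 : 1 < Nat.card N := by
        rw [← Subgroup.one_lt_card_iff_ne_bot] at hb; exact hb
      have h2 : 1 < N.index := by
        have : N.index ≠ 1 := fun h => ht (Subgroup.index_eq_one.1 h)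
        omega
      rw [Group.isSolvable_iff_subgroup_quotient N]
      constructor
      · apply ih (Nat.card N) (by rw [← hn, ← hmul]; nlinarith) N rfl
        intro r hr hd
        exact h r hr (hd.trans (Subgroup.card_subgroup_dvd_card N))
      · apply ih (Nat.card (G ⧸ N)) (by
          rw [← hn, ← hmul]; change N.index < _; nlinarith) (G ⧸ N) rfl
        intro r hr hd
        exact h r hr (hd.trans (Subgroup.card_quotient_dvd_card N))
    · push Not at hsimp
      have : IsSimpleGroup G := ⟨fun N hN => by
        by_cases hb : N = ⊥
        · exact Or.inl hb
        · exact Or.inr (hsimp N hN hb)⟩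
      have hc1 : Nat.card G ≠ 1 := Finite.one_lt_card.ne'
      obtain ⟨r, hr, hrd⟩ := Nat.exists_prime_and_dvd hc1
      rcases h r hr hrd with rfl | rfl
      · exact burnside_simple r q hr hq hrd h
      · exact burnside_simple r p hr hp hrd (fun s hs hsd => (h s hs hsd).symm)

lemma orbit_ncard {G : Type*} [Group G] (H K : Subgroup G) :
    (MulAction.orbit H ((1 : G) : G ⧸ K)).ncard = K.relIndex H := by
  rw [← MulAction.index_stabilizer, Subgroup.relIndex]
  congr 1
  ext x
  rw [MulAction.mem_stabilizer_iff, Subgroup.mem_subgroupOf]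
  change ((((x : G) * 1 : G) : G ⧸ K) = ((1 : G) : G ⧸ K)) ↔ _
  rw [eq_comm, QuotientGroup.eq]
  simp

lemma index_dvd_of_mul {G : Type*} [Group G] [Finite G] (V T : Subgroup G)
    (h : ∀ g : G, ∃ v ∈ V, ∃ t ∈ T, v * t = g) : T.index ∣ Nat.card V := by
  have h1 : MulAction.orbit V ((1 : G) : G ⧸ T) = Set.univ := by
    ext x
    simp only [Set.mem_univ, iff_true]
    induction x using QuotientGroup.induction_on with
    | H g =>
      obtain ⟨v, hv, t, ht, rfl⟩ := h g
      refine ⟨⟨v, hv⟩, ?_⟩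
      change ((v * 1 : G) : G ⧸ T) = _
      rw [QuotientGroup.eq]
      simpa using ht
  have h2 := orbit_ncard V T
  rw [h1, Set.ncard_univ] at h2
  change T.index = _ at h2
  rw [h2]
  exact Subgroup.index_dvd_card _

lemma mul_of_coprime_s5 {G : Type*} [Group G] [Finite G] (H K : Subgroup G)
    (h : Nat.Coprime H.index K.index) (g : G) : ∃ x ∈ H, ∃ y ∈ K, x * y = g := by
  have h1 : K.index ∣ K.relIndex H := by
    have h2 : (K ⊓ H).relIndex H * H.index = (K ⊓ H).index :=
      Subgroup.relIndex_mul_index inf_le_right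
    rw [Subgroup.inf_relIndex_right] at h2
    have h3 : K.index ∣ (K ⊓ H).index := Subgroup.index_dvd_of_le inf_le_left
    rw [← h2] at h3
    exact h.symm.dvd_of_dvd_mul_right h3
  have h2 := orbit_ncard H K
  have h3 : MulAction.orbit H ((1 : G) : G ⧸ K) = Set.univ := by
    apply Set.eq_of_subset_of_ncard_le (Set.subset_univ _) _ (Set.toFinite _)
    rw [h2, Set.ncard_univ]
    exact Nat.le_of_dvd (Nat.pos_of_ne_zero (Subgroup.index_ne_zero_of_finite)) h1
  have h4 : (g : G ⧸ K) ∈ MulAction.orbit H ((1 : G) : G ⧸ K) := by rw [h3]; trivial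
  obtain ⟨x, hx⟩ := h4
  change (((x : G) * 1 : G) : G ⧸ K) = _ at hx
  rw [QuotientGroup.eq] at hx
  refine ⟨x, x.2, _, hx, by simp⟩

lemma exists_abelian_normal (H : Type*) [Group H] [Nontrivial H] [hs : Group.IsSolvable H] :
    ∃ A : Subgroup H, A.Normal ∧ A ≠ ⊥ ∧ ∀ x ∈ A, ∀ y ∈ A, x * y = y * x := by
  classical
  have hex := hs.solvable
  have hm := Nat.find_spec hex
  have hmin := fun k => Nat.find_min (H := hex) (m := k)
  generalize Nat.find hex = m at hm hmin
  cases m with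
  | zero => simp at hm
  | succ k =>
    refine ⟨derivedSeries H k, inferInstance, hmin k (by omega), ?_⟩
    intro x hx y hy
    have h1 := Subgroup.commutator_mem_commutator hx hy
    rw [← derivedSeries_succ, hm, Subgroup.mem_bot, commutatorElement_eq_one_iff_mul_comm] at h1
    exact h1

lemma wielandt_step {G : Type*} [Group G] [Finite G] (H : Subgroup G) [Group.IsSolvable H]
    (hH : H ≠ ⊥) : ∃ (p : ℕ) (M : Subgroup G), p.Prime ∧ M ≠ ⊥ ∧ IsPGroup p M ∧
      ∀ h ∈ H, ∀ m ∈ M, h * m * h⁻¹ ∈ M := by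
  have : Nontrivial H := (Subgroup.nontrivial_iff_ne_bot H).2 hH
  obtain ⟨A, hA, hAb, hAc⟩ := exists_abelian_normal H
  obtain ⟨p, hp, hpd⟩ := Nat.exists_prime_and_dvd
    ((Subgroup.one_lt_card_iff_ne_bot (H := A)).2 hAb).ne'
  have : Fact p.Prime := ⟨hp⟩
  let M0 : Subgroup H :=
    { carrier := {x | x ∈ A ∧ x ^ p = 1}
      one_mem' := ⟨A.one_mem, one_pow _⟩
      mul_mem' := by
        rintro a b ⟨ha, ha'⟩ ⟨hb, hb'⟩
        refine ⟨A.mul_mem ha hb, ?_⟩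
        rw [Commute.mul_pow (hAc a ha b hb), ha', hb', one_mul]
      inv_mem' := by
        rintro a ⟨ha, ha'⟩
        exact ⟨A.inv_mem ha, by rw [inv_pow, ha', inv_one]⟩ }
  refine ⟨p, M0.map H.subtype, hp, ?_, ?_, ?_⟩
  · obtain ⟨x, hx⟩ := exists_prime_orderOf_dvd_card' p hpd
    intro hbot
    have h1 : ((x : H) : G) ∈ M0.map H.subtype := by
      refine ⟨x, ⟨x.2, ?_⟩, rfl⟩
      have := pow_orderOf_eq_one x
      rw [hx] at this
      exact congrArg Subtype.val this
    rw [hbot, Subgroup.mem_bot] at h1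
    have h2 : x = 1 := by
      ext; exact h1
    rw [h2, orderOf_one] at hx
    exact hp.one_lt.ne hx
  · rintro ⟨_, ⟨x, ⟨hx, hx'⟩, rfl⟩⟩
    refine ⟨1, ?_⟩
    ext
    have := congrArg Subtype.val hx'
    simpa using this
  · rintro h hh _ ⟨x, ⟨hx, hx'⟩, rfl⟩
    refine ⟨⟨h, hh⟩ * x * ⟨h, hh⟩⁻¹, ⟨hA.conj_mem x hx _, ?_⟩, rfl⟩
    rw [conj_pow, hx']; simp

lemma wielandt_normal {G : Type*} [Group G] [Finite G] (H K : Subgroup G) [Group.IsSolvable K]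
    (hc : Nat.Coprime H.index K.index) (p : ℕ) (hp : p.Prime) (hpK : ¬ p ∣ K.index)
    (M : Subgroup G) (hM : IsPGroup p M) (hMH : ∀ h ∈ H, ∀ m ∈ M, h * m * h⁻¹ ∈ M) :
    Group.IsSolvable (Subgroup.normalClosure (M : Set G)) := by
  have : Fact p.Prime := ⟨hp⟩
  obtain ⟨a, ha⟩ := hM.nonempty_fixed_point_of_prime_not_dvd_card (G ⧸ K) hpK
  obtain ⟨g, rfl⟩ := QuotientGroup.mk_surjective a
  let K' : Subgroup G := K.map (MulAut.conj g).toMonoidHom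
  have hMK : ∀ m ∈ M, m ∈ K' := by
    intro m hm
    have h1 := ha ⟨m, hm⟩
    change ((m * g : G) : G ⧸ K) = _ at h1
    rw [eq_comm, QuotientGroup.eq] at h1
    refine ⟨_, h1, ?_⟩
    simp [mul_assoc]
  have hidx : K'.index = K.index := Subgroup.index_map_equiv K (MulAut.conj g)
  have hle : Subgroup.normalClosure (M : Set G) ≤ K' := by
    rw [Subgroup.normalClosure, Subgroup.closure_le]
    intro x hx
    obtain ⟨m, hm, hmx⟩ := Group.mem_conjugatesOfSet_iff.1 hx
    obtain ⟨y, rfl⟩ := isConj_iff.1 hmx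
    obtain ⟨k, hk, h, hh, rfl⟩ := mul_of_coprime_s5 K' H (by rw [hidx]; exact hc.symm) y
    have h1 := hMK _ (hMH h hh m hm)
    have h2 := K'.mul_mem (K'.mul_mem hk h1) (K'.inv_mem hk)
    have h3 : k * h * m * (k * h)⁻¹ = k * (h * m * h⁻¹) * k⁻¹ := by group
    rw [h3]; exact h2
  have : Group.IsSolvable K' :=
    Group.isSolvable_of_surjective ((MulAut.conj g).toMonoidHom.subgroupMap_surjective K)
  exact Group.isSolvable_of_isSolvable_injective (Subgroup.inclusion_injective hle)

lemma wielandt (n : ℕ) :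
    ∀ (G : Type u) [Group G] [Finite G], Nat.card G = n →
    ∀ H K L : Subgroup G, Group.IsSolvable H → Group.IsSolvable K → Group.IsSolvable L →
    Nat.Coprime H.index K.index → Nat.Coprime H.index L.index → Nat.Coprime K.index L.index →
    Group.IsSolvable G := by
  induction n using Nat.strong_induction_on with
  | _ n ih =>
    intro G _ _ hn H K L hH hK hL hHK hHL hKL
    by_cases hb : H = ⊥
    · have h1 : K.index = 1 := by
        rw [hb, Subgroup.index_bot] at hHK
        exact Nat.eq_one_of_dvd_coprimes hHK K.index_dvd_card dvd_rfl
      rw [Subgroup.index_eq_one] at h1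
      subst h1
      exact Group.isSolvable_of_surjective
        (f := (Subgroup.topEquiv : (⊤ : Subgroup G) ≃* G).toMonoidHom) Subgroup.topEquiv.surjective
    obtain ⟨p, M, hp, hMb, hMp, hMH⟩ := wielandt_step H hb
    have hsol : Group.IsSolvable (Subgroup.normalClosure (M : Set G)) := by
      by_cases hpK : p ∣ K.index
      · have hpL : ¬ p ∣ L.index := fun h =>
          hp.one_lt.ne' (Nat.eq_one_of_dvd_coprimes hKL hpK h)
        exact wielandt_normal H L hHL p hp hpL M hMp hMH
      · exact wielandt_normal H K hHK p hp hpK M hMp hMH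
    set N := Subgroup.normalClosure (M : Set G) with hNdef
    have hNb : N ≠ ⊥ := by
      intro h
      apply hMb
      rw [eq_bot_iff, ← h]
      exact Subgroup.le_normalClosure
    have hlt : Nat.card (G ⧸ N) < n := by
      have hmul := N.card_mul_index
      have h1 : 1 < Nat.card N := (Subgroup.one_lt_card_iff_ne_bot (H := N)).2 hNb
      have h2 : 0 < N.index := Nat.pos_of_ne_zero N.index_ne_zero_of_finite
      rw [← hn, ← hmul]
      change N.index < _
      nlinarith
    rw [Group.isSolvable_iff_subgroup_quotient N]
    refine ⟨hsol, ?_⟩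
    have hsurj := QuotientGroup.mk'_surjective N
    have hd := fun X : Subgroup G => Subgroup.index_map_dvd X hsurj
    have hs : ∀ X : Subgroup G, Group.IsSolvable X →
        Group.IsSolvable (X.map (QuotientGroup.mk' N)) := fun X hX =>
      Group.isSolvable_of_surjective ((QuotientGroup.mk' N).subgroupMap_surjective X)
    exact ih _ hlt (G ⧸ N) rfl _ _ _ (hs H hH) (hs K hK) (hs L hL)
      ((hHK.coprime_dvd_left (hd H)).coprime_dvd_right (hd K))
      ((hHL.coprime_dvd_left (hd H)).coprime_dvd_right (hd L))
      ((hKL.coprime_dvd_left (hd K)).coprime_dvd_right (hd L))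

end grouptheory

open scoped Pointwise

/-- If every maximal subgroup of every Sylow subgroup of a finite group `G` has a
soluble supplement in `G`, then `G` is soluble. -/
theorem solvable_of_supplements (G : Type*) [Group G] [Finite G]
    (hsupp : ∀ p : ℕ, p.Prime → p ∣ Nat.card G →
      ∀ (P : Sylow p G) (V : Subgroup G), V < ↑P →
        (∀ W : Subgroup G, V < W → W ≤ ↑P → W = ↑P) →
        ∃ T : Subgroup G, (V : Set G) * (T : Set G) = Set.univ ∧ IsSolvable ↥T) :
    IsSolvable G := by
  have key : ∀ p : ℕ, p.Prime → p ∣ Nat.card G →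
      ∃ T : Subgroup G, Group.IsSolvable T ∧ ∃ k, T.index ∣ p ^ k := by
    intro p hp hpd
    have : Fact p.Prime := ⟨hp⟩
    obtain ⟨P⟩ : Nonempty (Sylow p G) := inferInstance
    have hPb : (⊥ : Subgroup G) < P := by
      rw [bot_lt_iff_ne_bot, ← Subgroup.one_lt_card_iff_ne_bot]
      exact hp.one_lt.trans_le (Nat.le_of_dvd Nat.card_pos (P.dvd_card_of_dvd_card hpd))
    obtain ⟨V, hV⟩ := (Set.toFinite {V : Subgroup G | V < P}).exists_maximal ⟨⊥, hPb⟩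
    obtain ⟨T, hT, hTs⟩ := hsupp p hp hpd P V hV.1 (by
      intro W hVW hWP
      by_contra hne
      exact absurd (hV.2 (lt_of_le_of_ne hWP hne) hVW.le) (not_le_of_gt hVW))
    refine ⟨T, hTs, ?_⟩
    obtain ⟨k, hk⟩ := IsPGroup.iff_card.1 P.isPGroup'
    refine ⟨k, ?_⟩
    rw [← hk]
    refine (index_dvd_of_mul V T ?_).trans (Subgroup.card_dvd_of_le hV.1.le)
    intro g
    have : g ∈ (V : Set G) * (T : Set G) := by rw [hT]; trivial
    obtain ⟨v, hv, t, ht, h⟩ := Set.mem_mul.1 this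
    exact ⟨v, hv, t, ht, h⟩
  have cop : ∀ {p q a b i j : ℕ}, p.Prime → q.Prime → p ≠ q → i ∣ p ^ a → j ∣ q ^ b →
      Nat.Coprime i j := fun hp hq hne hi hj =>
    (((Nat.coprime_primes hp hq).2 hne).pow _ _).coprime_dvd_left hi |>.coprime_dvd_right hj
  by_cases h2 : ∃ p q : ℕ, p.Prime ∧ q.Prime ∧
      ∀ r : ℕ, r.Prime → r ∣ Nat.card G → r = p ∨ r = q
  · obtain ⟨p, q, hp, hq, h⟩ := h2
    exact burnside_paqb p q hp hq _ G rfl h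
  · push Not at h2
    obtain ⟨p, hp, hpd, -, -⟩ := h2 2 2 Nat.prime_two Nat.prime_two
    obtain ⟨q, hq, hqd, hqp, -⟩ := h2 p p hp hp
    obtain ⟨r, hr, hrd, hrp, hrq⟩ := h2 p q hp hq
    obtain ⟨A, hA, a, ha⟩ := key p hp hpd
    obtain ⟨B, hB, b, hb⟩ := key q hq hqd
    obtain ⟨C, hC, c, hc⟩ := key r hr hrd
    exact wielandt _ G rfl A B C hA hB hC (cop hp hq hqp.symm ha hb)
      (cop hp hr hrp.symm ha hc) (cop hq hr hrq.symm hb hc)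
end

section
/- Let G be a finite group. Suppose that for every prime p dividing |G|, every Sylow p-subgroup P of G, and every maximal subgroup V of P, there exists a subgroup T of G with VT = G such that T is nilpotent. Then G is nilpotent. -/
open scoped Pointwise

lemma grp_split (T : Type*) [Group T] [Finite T] [Group.IsNilpotent T] (p : ℕ) [hp : Fact p.Prime] :
    ∃ (A : Sylow p T) (B : Subgroup T), Subgroup.IsComplement' (A : Subgroup T) B ∧
      (∀ a ∈ A, ∀ b ∈ B, a * b = b * a) ∧
      ∀ x : T, IsPGroup p (Subgroup.zpowers x) → x ∈ A := by
  obtain ⟨A⟩ := (inferInstance : Nonempty (Sylow p T))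
  have hA : (A : Subgroup T).Normal := inferInstance
  have hcop := A.card_coprime_index
  obtain ⟨B, hB⟩ := Subgroup.exists_right_complement'_of_coprime hcop
  refine ⟨A, B, hB, ?_, ?_⟩
  · have hq : ∀ q : ℕ, q.Prime → q ≠ p →
        ¬ q ∣ (Subgroup.centralizer ((A : Subgroup T) : Set T)).index := by
      intro q hq hqp hdvd
      have : Fact q.Prime := ⟨hq⟩
      obtain ⟨Q⟩ := (inferInstance : Nonempty (Sylow q T))
      have hQ : (Q : Subgroup T).Normal := inferInstance
      have hdis : Disjoint (A : Subgroup T) (Q : Subgroup T) :=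
        IsPGroup.disjoint_of_ne p q hqp.symm _ _ A.isPGroup' Q.isPGroup'
      have hle : (Q : Subgroup T) ≤ Subgroup.centralizer ((A : Subgroup T) : Set T) := by
        intro x hx
        rw [Subgroup.mem_centralizer_iff]
        intro a ha
        exact Subgroup.commute_of_normal_of_disjoint _ _ hA hQ hdis a x ha hx
      exact Q.not_dvd_index (hdvd.trans (Subgroup.index_dvd_of_le hle))
    have hBle : B ≤ Subgroup.centralizer ((A : Subgroup T) : Set T) := by
      rw [← Subgroup.relIndex_eq_one]
      by_contra hne
      obtain ⟨q, hqp, hqd⟩ := Nat.exists_prime_and_dvd hne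
      have h1 : q ∣ (Subgroup.centralizer ((A : Subgroup T) : Set T)).index :=
        hqd.trans (Subgroup.relIndex_dvd_index_of_normal _ _)
      have h2 : q = p := by
        by_contra h
        exact hq q hqp h h1
      have h3 : q ∣ Nat.card B := hqd.trans (Subgroup.relIndex_dvd_card _ _)
      rw [← hB.symm.index_eq_card] at h3
      subst h2
      exact A.not_dvd_index h3
    intro a ha b hb
    exact Subgroup.mem_centralizer_iff.mp (hBle hb) a ha
  · intro x hx
    obtain ⟨Q, hQ⟩ := hx.exists_le_sylow
    have := Sylow.unique_of_normal A hA
    have : Q = A := Subsingleton.elim _ _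
    rw [← this]
    exact hQ (Subgroup.mem_zpowers x)

lemma sub_split {G : Type*} [Group G] [Finite G] (T : Subgroup G) (hT : Group.IsNilpotent T)
    (p : ℕ) [hp : Fact p.Prime] :
    ∃ A B : Subgroup G, A ≤ T ∧ B ≤ T ∧ Group.IsNilpotent B ∧
      Nat.card A = p ^ (Nat.card T).factorization p ∧ Nat.card A * Nat.card B = Nat.card T ∧
      (∀ a ∈ A, ∀ b ∈ B, a * b = b * a) ∧
      (∀ x ∈ T, IsPGroup p (Subgroup.zpowers x) → x ∈ A) ∧
      A ⊔ B = T := by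
  obtain ⟨A, B, h1, h2, h3⟩ := grp_split T p
  refine ⟨(A : Subgroup T).map T.subtype, B.map T.subtype, Subgroup.map_subtype_le _,
    Subgroup.map_subtype_le _, ?_, ?_, ?_, ?_, ?_, ?_⟩
  · exact Group.nilpotent_of_mulEquiv
      (B.equivMapOfInjective T.subtype T.subtype_injective)
  · rw [Subgroup.card_map_of_injective T.subtype_injective]
    exact A.card_eq_multiplicity
  · rw [Subgroup.card_map_of_injective T.subtype_injective,
      Subgroup.card_map_of_injective T.subtype_injective]
    exact h1.card_mul_card
  · rintro _ ⟨a, ha, rfl⟩ _ ⟨b, hb, rfl⟩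
    exact congrArg Subtype.val (h2 a ha b hb)
  · intro x hx hp
    refine ⟨⟨x, hx⟩, h3 _ ?_, rfl⟩
    rw [IsPGroup.iff_card] at hp ⊢
    rw [Nat.card_zpowers] at hp ⊢
    rwa [Subgroup.orderOf_mk]
  · rw [← Subgroup.map_sup, h1.sup_eq_top, ← MonoidHom.range_eq_map, Subgroup.range_subtype]

lemma card_smul' {G : Type*} [Group G] (g : G) (H : Subgroup G) :
    Nat.card (MulAut.conj g • H : Subgroup G) = Nat.card H :=
  (Nat.card_congr (Subgroup.equivSMul (MulAut.conj g) H).toEquiv).symm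

lemma nil_smul {G : Type*} [Group G] (g : G) (H : Subgroup G) (hH : Group.IsNilpotent H) :
    Group.IsNilpotent (MulAut.conj g • H : Subgroup G) :=
  Group.nilpotent_of_mulEquiv (Subgroup.equivSMul (MulAut.conj g) H)

lemma wielandt_s6 {G : Type*} [Group G] [Finite G] (n : ℕ) (hn : n.Coprime (Nat.card G / n)) :
    ∀ (C H K : Subgroup G), H ≤ C → K ≤ C → Group.IsNilpotent H → Group.IsNilpotent K →
      Nat.card H = n → Nat.card K = n → ∃ g ∈ C, MulAut.conj g • H = K := by
  induction n using Nat.strong_induction_on with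
  | _ n ih =>
  intro C H K hHC hKC hH hK cH cK
  by_cases h1 : n = 1
  · subst h1
    rw [Subgroup.card_eq_one] at cH cK
    subst cH cK
    exact ⟨1, C.one_mem, by simp⟩
  obtain ⟨p, pp, hpn⟩ := Nat.exists_prime_and_dvd h1
  have : Fact p.Prime := ⟨pp⟩
  have hnG : n ∣ Nat.card G := cH ▸ Subgroup.card_subgroup_dvd_card H
  have hn0 : n ≠ 0 := by rw [← cH]; exact Nat.card_pos.ne'
  obtain ⟨m, hm⟩ := hnG
  have hm0 : m ≠ 0 := by
    rintro rfl
    exact Nat.card_pos.ne' hm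
  rw [hm, Nat.mul_div_cancel_left _ (Nat.pos_of_ne_zero hn0)] at hn
  have hfac : (Nat.card G).factorization p = n.factorization p := by
    rw [hm, Nat.factorization_mul hn0 hm0]
    have : ¬ p ∣ m := fun h => pp.one_lt.ne' (Nat.dvd_one.mp (hn ▸ Nat.dvd_gcd hpn h))
    simp [Nat.factorization_eq_zero_of_not_dvd this]
  obtain ⟨A, B, hAH, hBH, nB, cA, cAB, hcomm, -, hsup⟩ := sub_split H hH p
  obtain ⟨A', B', hAK, hBK, nB', cA', cAB', hcomm', -, hsup'⟩ := sub_split K hK p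
  rw [cH] at cA cAB
  rw [cK] at cA' cAB'
  have cA1 := cA
  have cA1' := cA'
  rw [← hfac] at cA cA'
  let P := Sylow.ofCard A cA
  let P' := Sylow.ofCard A' cA'
  have hPC : (P : Subgroup G) ≤ C := hAH.trans hHC
  have hPC' : (P' : Subgroup G) ≤ C := hAK.trans hKC
  obtain ⟨c, hc⟩ := MulAction.exists_smul_eq C (P.subtype hPC) (P'.subtype hPC')
  rw [Sylow.smul_subtype] at hc
  have hc2 := Sylow.subtype_injective hc
  have hc3 : MulAut.conj (c : G) • A = A' := congrArg Sylow.toSubgroup hc2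
  -- order of B
  have hB0 : Nat.card B ≠ 0 := Nat.card_pos.ne'
  have hApos : 0 < Nat.card A := Nat.card_pos
  have hcBB' : Nat.card B = Nat.card B' := by
    apply Nat.eq_of_mul_eq_mul_left hApos
    rw [cAB, cA, ← cA', cAB']
  have hpA : p ∣ Nat.card A := by
    rw [cA1]
    exact dvd_pow_self _ ((pp.factorization_pos_of_dvd hn0 hpn).ne')
  have hlt : Nat.card B < n := by
    rw [← cAB]
    have : 1 < Nat.card A := lt_of_lt_of_le pp.one_lt (Nat.le_of_dvd hApos hpA)
    nlinarith [Nat.pos_of_ne_zero hB0]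
  have hABc : (Nat.card B).Coprime (Nat.card A) := by
    rw [cA1]
    apply Nat.Coprime.pow_right
    rw [Nat.coprime_comm, pp.coprime_iff_not_dvd]
    have : Nat.card B = n / p ^ n.factorization p := by
      rw [← cA1, ← cAB, Nat.mul_div_cancel_left _ hApos]
    rw [this]
    exact Nat.not_dvd_ordCompl pp hn0
  have hBc : (Nat.card B).Coprime (Nat.card G / Nat.card B) := by
    have : Nat.card G / Nat.card B = Nat.card A * m := by
      apply Nat.div_eq_of_eq_mul_right (Nat.pos_of_ne_zero hB0)
      rw [hm, ← cAB]; ring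
    rw [this]
    exact Nat.Coprime.mul_right hABc (hn.coprime_dvd_left ⟨Nat.card A, by rw [← cAB]; ring⟩)
  obtain ⟨d, hd, hd2⟩ := ih _ hlt hBc (C ⊓ Subgroup.centralizer (A' : Set G))
    (MulAut.conj (c : G) • B) B'
    (by
      refine le_inf (Subgroup.conj_smul_le_of_le (hBH.trans hHC) c) ?_
      rintro x hx
      rw [Subgroup.mem_centralizer_iff]
      intro y hy
      rw [← hc3] at hy
      obtain ⟨b, hb, rfl⟩ := hx
      obtain ⟨a, ha, rfl⟩ := hy
      have := congrArg (MulAut.conj (c : G)) (hcomm a ha b hb)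
      rw [map_mul, map_mul] at this; exact this)
    (by
      refine le_inf (hBK.trans hKC) ?_
      intro x hx
      rw [Subgroup.mem_centralizer_iff]
      intro y hy
      exact hcomm' y hy x hx)
    (nil_smul _ _ nB) nB' (card_smul' _ _) hcBB'.symm
  refine ⟨d * c, C.mul_mem hd.1 c.2, ?_⟩
  have hdA : MulAut.conj d • A' = A' := by
    have hd' := Subgroup.mem_centralizer_iff.mp hd.2
    apply Subgroup.eq_of_le_of_card_ge
    · rintro _ ⟨a, ha, rfl⟩
      have : d * a * d⁻¹ = a := by rw [← hd' a ha]; group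
      change d * a * d⁻¹ ∈ A'
      rwa [this]
    · rw [card_smul']
  rw [← hsup, ← hsup', map_mul, mul_smul, Subgroup.smul_sup, Subgroup.smul_sup, hc3, hdA, hd2]

lemma max_normal {G : Type*} [Group G] [Finite G] {p : ℕ} [Fact p.Prime] (P V : Subgroup G)
    (hP : IsPGroup p P) (hV : V < P) (hmax : ∀ W : Subgroup G, V < W → W ≤ P → W = P) :
    ∀ a ∈ P, ∀ v ∈ V, a * v * a⁻¹ ∈ V := by
  have hnil : Group.IsNilpotent P := hP.isNilpotent
  have hco : IsCoatom (V.subgroupOf P) := by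
    constructor
    · intro h
      exact hV.not_ge (Subgroup.subgroupOf_eq_top.mp h)
    · intro W hW
      have h1 : V < W.map P.subtype := by
        have := (Subgroup.map_lt_map_iff_of_injective P.subtype_injective).mpr hW
        rwa [Subgroup.subgroupOf_map_subtype, inf_eq_left.mpr hV.le] at this
      have h2 := hmax _ h1 (Subgroup.map_subtype_le _)
      rw [eq_top_iff]
      rintro ⟨x, hx⟩ -
      have hx' := hx
      rw [← h2] at hx'
      obtain ⟨w, hw, hwx⟩ := hx'
      have : w = ⟨x, hx⟩ := Subtype.ext hwx
      rwa [← this]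
  have hn := Subgroup.NormalizerCondition.normal_of_coatom _ Group.normalizerCondition_of_isNilpotent hco
  intro a ha v hv
  exact hn.conj_mem ⟨v, hV.le hv⟩ hv ⟨a, ha⟩

lemma hall_of_supp {G : Type*} [Group G] [Finite G] {p : ℕ} [Fact p.Prime] (V T : Subgroup G)
    (hV : IsPGroup p V) (hVT : (V : Set G) * (T : Set G) = Set.univ) :
    Nat.card T / p ^ (Nat.card T).factorization p
      = Nat.card G / p ^ (Nat.card G).factorization p := by
  have hp : p.Prime := Fact.out
  have : MulAction.IsPretransitive V (G ⧸ T) := by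
    refine (MulAction.isPretransitive_iff_base ((1 : G) : G ⧸ T)).mpr ?_
    intro y
    obtain ⟨g, rfl⟩ := QuotientGroup.mk_surjective y
    have hg : g ∈ (V : Set G) * (T : Set G) := hVT ▸ Set.mem_univ g
    obtain ⟨v, hv, t, ht, rfl⟩ := hg
    refine ⟨⟨v, hv⟩, ?_⟩
    change ((v * 1 : G) : G ⧸ T) = ((v * t : G) : G ⧸ T)
    rw [QuotientGroup.eq]
    simpa using ht
  have h1 : T.index ∣ Nat.card V := by
    rw [Subgroup.index_eq_card, ← MulAction.index_stabilizer_of_transitive V ((1 : G) : G ⧸ T)]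
    exact Subgroup.index_dvd_card _
  obtain ⟨k, hk⟩ := IsPGroup.iff_card.mp hV
  rw [hk] at h1
  obtain ⟨j, -, hj⟩ := (Nat.dvd_prime_pow hp).mp h1
  have h2 := T.card_mul_index
  rw [hj] at h2
  have hT0 : Nat.card T ≠ 0 := Nat.card_pos.ne'
  rw [← h2, Nat.factorization_mul hT0 (pow_ne_zero _ hp.ne_zero), hp.factorization_pow]
  simp only [Finsupp.add_apply, Finsupp.single_eq_same, pow_add]
  rw [Nat.mul_div_mul_right _ _ (pow_pos hp.pos _)]

/-- If every maximal subgroup of every Sylow subgroup of a finite group `G` has a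
nilpotent supplement in `G`, then `G` is nilpotent. -/
theorem nilpotent_of_supplements (G : Type*) [Group G] [Finite G]
    (hsupp : ∀ p : ℕ, p.Prime → p ∣ Nat.card G →
      ∀ (P : Sylow p G) (V : Subgroup G), V < ↑P →
        (∀ W : Subgroup G, V < W → W ≤ ↑P → W = ↑P) →
        ∃ T : Subgroup G, (V : Set G) * (T : Set G) = Set.univ ∧ Group.IsNilpotent ↥T) :
    Group.IsNilpotent G := by
  by_cases h1 : Nat.card G = 1
  · have : Subsingleton G := (Nat.card_eq_one_iff_unique.mp h1).1
    infer_instance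
  obtain ⟨p, pp, hpG⟩ := Nat.exists_prime_and_dvd h1
  have : Fact p.Prime := ⟨pp⟩
  obtain ⟨P⟩ := (inferInstance : Nonempty (Sylow p G))
  have hG0 : Nat.card G ≠ 0 := Nat.card_pos.ne'
  set n := Nat.card G / p ^ (Nat.card G).factorization p with hn
  have cP : Nat.card P = p ^ (Nat.card G).factorization p := P.card_eq_multiplicity
  have hmul : Nat.card P * n = Nat.card G := by
    rw [cP]; exact Nat.ordProj_mul_ordCompl_eq_self _ _
  have hPn : (Nat.card P).Coprime n := by
    rw [cP]
    exact Nat.Coprime.pow_left _ (Nat.coprime_ordCompl pp hG0)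
  have hn0 : 0 < n := Nat.pos_of_ne_zero (by rintro h; rw [h] at hmul; omega)
  have hnc : n.Coprime (Nat.card G / n) := by
    rw [← hmul, Nat.mul_div_cancel _ hn0]
    exact hPn.symm
  -- every proper subgroup of `P` lies in a maximal one, which gives a Hall subgroup
  have key : ∀ D : Subgroup G, D < P → ∃ (V B : Subgroup G) (t : G), D ≤ V ∧
      (∀ a ∈ (P : Subgroup G), ∀ v ∈ V, a * v * a⁻¹ ∈ V) ∧ t ∈ (P : Subgroup G) ∧ t ∉ V ∧
      Group.IsNilpotent B ∧ Nat.card B = n ∧ ∀ b ∈ B, t * b = b * t := by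
    intro D hD
    obtain ⟨V, hDV, hV⟩ := Finite.exists_le_maximal (p := fun W : Subgroup G => W < P) hD
    have hVP : V < (P : Subgroup G) := hV.prop
    have hmax : ∀ W : Subgroup G, V < W → W ≤ ↑P → W = ↑P := by
      intro W hVW hWP
      by_contra hne
      exact hVW.not_ge (hV.le_of_ge (lt_of_le_of_ne hWP hne) hVW.le)
    obtain ⟨T, hVT, hT⟩ := hsupp p pp hpG P V hVP hmax
    obtain ⟨A, B, -, -, nB, cA, cAB, hcomm, hpA, -⟩ := sub_split T hT p
    obtain ⟨x, hxP, hxV⟩ := SetLike.exists_of_lt hVP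
    have hx : x ∈ (V : Set G) * (T : Set G) := hVT ▸ Set.mem_univ x
    obtain ⟨v, hv, t, ht, rfl⟩ := hx
    have htP : t ∈ (P : Subgroup G) := (Subgroup.mul_mem_cancel_left _ (hVP.le hv)).mp hxP
    have htV : t ∉ V := fun h => hxV (V.mul_mem hv h)
    refine ⟨V, B, t, hDV, max_normal _ V P.isPGroup' hVP hmax, htP, htV, nB, ?_, ?_⟩
    · rw [hn, ← hall_of_supp V T (P.isPGroup'.to_le hVP.le) hVT, ← cA, ← cAB,
        Nat.mul_div_cancel_left _ Nat.card_pos]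
    · intro b hb
      refine hcomm t (hpA t ht (P.isPGroup'.to_le ?_)) b hb
      rwa [Subgroup.zpowers_le]
  have hbot : (⊥ : Subgroup G) < P := by
    rw [bot_lt_iff_ne_bot]
    exact P.ne_bot_of_dvd_card hpG
  obtain ⟨-, H, -, -, -, -, -, nH, cH, -⟩ := key ⊥ hbot
  have hcompl : ∀ B : Subgroup G, Nat.card B = n → Subgroup.IsComplement' (P : Subgroup G) B := by
    intro B hB
    apply Subgroup.isComplement'_of_coprime
    · rw [hB]; exact hmul
    · rw [hB]; exact hPn
  have hle : (P : Subgroup G) ≤ Subgroup.centralizer (H : Set G) := by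
    by_contra hnot
    have hD : (P : Subgroup G) ⊓ Subgroup.centralizer (H : Set G) < P :=
      lt_of_le_of_ne inf_le_left (fun h => hnot (inf_eq_left.mp h))
    obtain ⟨V, B, t, hDV, hVn, htP, htV, nB, cB, hcomm⟩ := key _ hD
    obtain ⟨g, -, hg⟩ := wielandt_s6 n hnc ⊤ B H le_top le_top nB nH cB cH
    have hgm : g ∈ ((P : Subgroup G) : Set G) * (B : Set G) := by
      rw [(hcompl B cB).mul_eq]; trivial
    obtain ⟨a, ha, b, hb, rfl⟩ := hgm
    have hat : a * t * a⁻¹ ∈ V := by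
      apply hDV
      refine ⟨P.mul_mem (P.mul_mem ha htP) (P.inv_mem ha), ?_⟩
      refine Subgroup.mem_centralizer_iff.mpr ?_
      intro h hh
      have hh' : h ∈ H := hh
      rw [← hg] at hh'
      obtain ⟨c, hc, rfl⟩ := hh'
      change (a * b) * c * (a * b)⁻¹ * (a * t * a⁻¹) = (a * t * a⁻¹) * ((a * b) * c * (a * b)⁻¹)
      have e := hcomm (b * c * b⁻¹) (B.mul_mem (B.mul_mem hb hc) (B.inv_mem hb))
      calc _ = a * ((b * c * b⁻¹) * t) * a⁻¹ := by group
        _ = a * (t * (b * c * b⁻¹)) * a⁻¹ := by rw [e]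
        _ = _ := by group
    have := hVn a⁻¹ (P.inv_mem ha) _ hat
    apply htV
    convert this using 1
    group
  have hPnil : Group.IsNilpotent P := P.isPGroup'.isNilpotent
  let f : P × H →* G := MonoidHom.noncommCoprod (P : Subgroup G).subtype H.subtype
    (fun a b => (Subgroup.mem_centralizer_iff.mp (hle a.2) b b.2).symm)
  refine Group.nilpotent_of_surjective f ?_
  intro g
  have hgm : g ∈ ((P : Subgroup G) : Set G) * (H : Set G) := by
    rw [(hcompl H cH).mul_eq]; trivial
  obtain ⟨a, ha, b, hb, rfl⟩ := hgm
  exact ⟨(⟨a, ha⟩, ⟨b, hb⟩), rfl⟩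
end
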